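/- arXiv:1810.02763 — 10 statements merged into one kernel-verified Lean document; each statement's English description precedes it below -/
import Mathlib

section
/- Let S be a nonempty subset of ℝⁿ and let f, f' : ℝⁿ → ℝ. Suppose x* ∈ S satisfies f(x*) ≤ f(x) for all x ∈ S, and M ∈ ℝ satisfies f(x) ≤ M for all x ∈ S. Suppose x*' ∈ S satisfies f'(x*') ≤ f'(x) for all x ∈ S, and M' ∈ ℝ satisfies f'(x) ≤ M' for all x ∈ S and M' = f'(ȳ) for some ȳ ∈ S. Let ξ ∈ [0,1) be such that f(x) ≤ f'(x) ≤ f(x) + ξ(M − f(x*)) for every x ∈ S, where M = f(z̄) for some z̄ ∈ S. Let ε' ∈ (ξ/(1−ξ), 1] and set ε := ε'(1−ξ) − ξ. Then for every x◇ ∈ S with f(x◇) − f(x*) ≤ ε(M − f(x*)), one has f'(x◇) − f'(x*') ≤ ε'(M' − f'(x*')). -/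
/-- an ε-approximate solution for `f` is an ε'-approximate solution for any
objective `f'` sandwiched between `f` and `f + ξ(M − f(x*))`. -/
theorem stmt_0 (n : ℕ) (S : Set (Fin n → ℝ)) (hS : S.Nonempty)
    (f f' : (Fin n → ℝ) → ℝ)
    (xstar : Fin n → ℝ) (hxstarS : xstar ∈ S) (hxstar : ∀ x ∈ S, f xstar ≤ f x)
    (M : ℝ) (hM : ∀ x ∈ S, f x ≤ M) (hMatt : ∃ z ∈ S, M = f z)
    (xstar' : Fin n → ℝ) (hxstar'S : xstar' ∈ S) (hxstar' : ∀ x ∈ S, f' xstar' ≤ f' x)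
    (M' : ℝ) (hM' : ∀ x ∈ S, f' x ≤ M') (hM'att : ∃ y ∈ S, M' = f' y)
    (ξ : ℝ) (hξ0 : 0 ≤ ξ) (hξ1 : ξ < 1)
    (hsand : ∀ x ∈ S, f x ≤ f' x ∧ f' x ≤ f x + ξ * (M - f xstar))
    (ε' : ℝ) (hε'l : ξ / (1 - ξ) < ε') (hε'u : ε' ≤ 1)
    (ε : ℝ) (hε : ε = ε' * (1 - ξ) - ξ)
    (xd : Fin n → ℝ) (hxdS : xd ∈ S)
    (hxd : f xd - f xstar ≤ ε * (M - f xstar)) :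
    f' xd - f' xstar' ≤ ε' * (M' - f' xstar') := by
  obtain ⟨z, hzS, hz⟩ := hMatt
  have hε'0 : 0 ≤ ε' := (div_nonneg hξ0 (sub_nonneg.2 hξ1.le)).trans hε'l.le
  have hrange : (1 - ξ) * (M - f xstar) ≤ M' - f' xstar' := by
    linarith [(hsand z hzS).1, hM' z hzS, hxstar' xstar hxstarS, (hsand xstar hxstarS).2]
  have hscaled := mul_le_mul_of_nonneg_left hrange hε'0
  have hlower := (hxstar xstar' hxstar'S).trans (hsand xstar' hxstar'S).1
  subst hε
  linarith [(hsand xd hxdS).2]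
end

section
/- Let k be a positive integer, let c₁,…,c_k ≥ 0 be real numbers, and define c : ℝᵏ → ℝ by c(x) = Σ_{i=1}^k (−c_i x_i²). Let r_i ≤ s_i be reals for i = 1,…,k, let C = [r₁,s₁] × ⋯ × [r_k,s_k], and define the affine function η : ℝᵏ → ℝ by η(x) = Σ_{i=1}^k (−c_i(r_i+s_i)x_i + c_i r_i s_i). Then for every x ∈ C, η(x) ≤ c(x) ≤ η(x) + (1/4) Σ_{i=1}^k c_i(s_i − r_i)². -/
/-- the affine interpolant of a separable concave quadratic at the vertices of a
box is an underestimator with additive error at most `(1/4) Σ cᵢ (sᵢ − rᵢ)²`. -/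
theorem stmt_1 (k : ℕ) (hk : 0 < k) (c : Fin k → ℝ) (hc : ∀ i, 0 ≤ c i)
    (r s : Fin k → ℝ) (hrs : ∀ i, r i ≤ s i)
    (x : Fin k → ℝ) (hx : ∀ i, r i ≤ x i ∧ x i ≤ s i) :
    (∑ i, (-(c i) * (r i + s i) * x i + c i * r i * s i)) ≤ (∑ i, -(c i) * (x i) ^ 2) ∧
    (∑ i, -(c i) * (x i) ^ 2) ≤
      (∑ i, (-(c i) * (r i + s i) * x i + c i * r i * s i)) +
        (1 / 4) * ∑ i, c i * (s i - r i) ^ 2 := by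
  constructor
  · refine Finset.sum_le_sum fun i _ => ?_
    have h := mul_nonneg (hc i)
      (mul_nonneg (sub_nonneg.2 (hx i).1) (sub_nonneg.2 (hx i).2))
    linear_combination h
  · rw [Finset.mul_sum, ← Finset.sum_add_distrib]
    refine Finset.sum_le_sum fun i _ => ?_
    have h := mul_nonneg (hc i) (sq_nonneg (x i - (r i + s i) / 2))
    linear_combination h
end

section
/- Let k ≤ n be positive integers, let q₁,…,q_k ≥ 0 be real numbers, let h ∈ ℝⁿ, and define f : ℝⁿ → ℝ by f(x) = Σ_{i=1}^k (−q_i x_i²) + Σ_{i=1}^n h_i x_i. Let S ⊆ ℝⁿ, let x* ∈ S satisfy f(x*) ≤ f(x) for all x ∈ S, let x^l, x^u ∈ S, and let x∘ = (x^l + x^u)/2. Then f(x∘) ≥ f(x*) + (1/4) Σ_{i=1}^k q_i (x^u_i − x^l_i)². -/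
/-- the midpoint of any two points of `S` exceeds the minimum of the separable
concave quadratic `f` over `S` by at least a quarter of the weighted squared coordinate gaps. -/
theorem stmt_4 (k n : ℕ) (hk : 0 < k) (hkn : k ≤ n) (q : Fin k → ℝ) (hq : ∀ i, 0 ≤ q i)
    (h : Fin n → ℝ) (f : (Fin n → ℝ) → ℝ)
    (hf : ∀ x, f x = (∑ i : Fin k, -(q i) * (x (Fin.castLE hkn i)) ^ 2) + ∑ i, h i * x i)
    (S : Set (Fin n → ℝ)) (xstar : Fin n → ℝ) (hxstarS : xstar ∈ S)
    (hxstar : ∀ x ∈ S, f xstar ≤ f x)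
    (xl xu : Fin n → ℝ) (hxl : xl ∈ S) (hxu : xu ∈ S)
    (x0 : Fin n → ℝ) (hx0 : x0 = fun i => (xl i + xu i) / 2) :
    f x0 ≥ f xstar +
      (1 / 4) * ∑ i : Fin k, q i * (xu (Fin.castLE hkn i) - xl (Fin.castLE hkn i)) ^ 2 := by
  have midpoint_eq : f x0 = (f xl + f xu) / 2 +
      (1 / 4) * ∑ i : Fin k, q i * (xu (Fin.castLE hkn i) - xl (Fin.castLE hkn i)) ^ 2 := by
    have quadratic_part : ∑ i : Fin k, -(q i) * (x0 (Fin.castLE hkn i)) ^ 2 =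
        ((∑ i : Fin k, -(q i) * (xl (Fin.castLE hkn i)) ^ 2) +
          ∑ i : Fin k, -(q i) * (xu (Fin.castLE hkn i)) ^ 2) / 2 +
        (1 / 4) * ∑ i : Fin k, q i * (xu (Fin.castLE hkn i) - xl (Fin.castLE hkn i)) ^ 2 := by
      rw [← Finset.sum_add_distrib, Finset.sum_div, Finset.mul_sum, ← Finset.sum_add_distrib]
      refine Finset.sum_congr rfl fun i _ => ?_
      rw [hx0]
      ring
    have linear_part : ∑ i, h i * x0 i = ((∑ i, h i * xl i) + ∑ i, h i * xu i) / 2 := by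
      rw [← Finset.sum_add_distrib, Finset.sum_div]
      refine Finset.sum_congr rfl fun i _ => ?_
      rw [hx0]
      ring
    rw [hf x0, hf xl, hf xu, quadratic_part, linear_part]
    ring
  linarith [hxstar xl hxl, hxstar xu hxu]
end

section
/- Let m, n be positive integers, let Δ be a positive integer, let W ∈ ℤ^{m×n} be a matrix all of whose square submatrices have determinant of absolute value at most Δ, and let w ∈ ℤᵐ. Let P = {x ∈ ℝⁿ : Wx ≤ w}. Let x^l, x^u ∈ P ∩ ℤⁿ and let x∘ = (x^l + x^u)/2. Then there exist x⁻, x⁺ ∈ P ∩ ℤⁿ such that x∘ = (x⁻ + x⁺)/2 and |x⁺_i − x∘_i| = |x∘_i − x⁻_i| ≤ nΔ for every i = 1,…,n. -/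
open Matrix Module

/-- A matrix with trivial kernel over a field has an invertible square submatrix
using all of its columns. -/
lemma exists_det_submatrix_ne_zero {K T : Type*} [Field K] [Finite T] {s : ℕ}
    (M : Matrix T (Fin s) K) (hM : ∀ v, M *ᵥ v = 0 → v = 0) :
    ∃ r : Fin s → T, Function.Injective r ∧ (M.submatrix r id).det ≠ 0 := by
  have hrank : M.rank = s := by
    have hinj : Function.Injective M.mulVecLin :=
      (injective_iff_map_eq_zero M.mulVecLin).2 hM
    rw [Matrix.rank, LinearMap.finrank_range_of_inj hinj, finrank_fin_fun]
  rw [Matrix.rank_eq_finrank_span_row] at hrank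
  have h := Submodule.exists_fun_fin_finrank_span_eq K (Set.range M.row)
  rw [hrank] at h
  obtain ⟨f, hf, -, hli⟩ := h
  choose r hr using hf
  have hfr : (M.submatrix r id).row = f := funext hr
  refine ⟨r, fun a b hab => hli.injective ?_, ?_⟩
  · rw [← hr a, ← hr b, hab]
  · rw [← hfr, linearIndependent_rows_iff_isUnit, isUnit_iff_isUnit_det] at hli
    exact hli.ne_zero

/-- A vector spanning the space of vectors that vanish wherever it does, with respect to the rows
of `W` and the coordinates, is proportional to an integer vector bounded by the subdeterminants
of `W`. -/
lemma exists_int_multiple_of_elementary {m n Δ : ℕ} {W : Matrix (Fin m) (Fin n) ℤ}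
    (hW : ∀ (s : ℕ) (r : Fin s → Fin m) (c : Fin s → Fin n),
      Function.Injective r → Function.Injective c → |(W.submatrix r c).det| ≤ (Δ : ℤ))
    {y : Fin n → ℝ} (hy : y ≠ 0)
    (hel : ∀ z : Fin n → ℝ, (∀ j, ∑ i, (W j i : ℝ) * y i = 0 → ∑ i, (W j i : ℝ) * z i = 0) →
      (∀ i, y i = 0 → z i = 0) → ∃ a : ℝ, z = a • y) :
    ∃ (g : Fin n → ℤ) (a : ℝ), a ≠ 0 ∧ (∀ i, (g i : ℝ) = a * y i) ∧ ∀ i, |g i| ≤ Δ := by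
  obtain ⟨i₀, hi₀⟩ := Function.ne_iff.1 hy
  rw [Pi.zero_apply] at hi₀
  obtain ⟨s, ⟨e'⟩⟩ := Finite.exists_equiv_fin {i // y i ≠ 0 ∧ i ≠ i₀}
  let e := e'.symm
  let c : Fin s → Fin n := fun k => (e k).1
  have hc : Function.Injective c := Subtype.val_injective.comp e.injective
  have hc₀ : ∀ k, c k ≠ i₀ := fun k => (e k).2.2
  have hi₀c : ¬ ∃ k, c k = i₀ := fun ⟨k, hk⟩ => hc₀ k hk
  have hcy : ∀ i, i ≠ i₀ → (¬ ∃ k, c k = i) → y i = 0 := by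
    intro i hi h
    by_contra h0
    exact h ⟨e.symm ⟨i, h0, hi⟩, by simp [c]⟩
  let M : Matrix {j // ∑ i, (W j i : ℝ) * y i = 0} (Fin s) ℝ := of fun j k => (W j.1 (c k) : ℝ)
  have hM : ∀ v, M *ᵥ v = 0 → v = 0 := by
    intro v hv
    obtain ⟨a, ha⟩ := hel (Function.extend c v 0) (fun j hj => by
      have h := congrFun hv ⟨j, hj⟩
      rw [← Fintype.sum_of_injective c hc (fun k => (W j (c k) : ℝ) * v k)]
      · exact h
      · intro i hi
        rw [Function.extend_apply' _ _ _ (by simpa using hi)]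
        simp
      · intro k
        rw [hc.extend_apply]) (fun i hi => by
      rw [Function.extend_apply' _ _ _ (fun ⟨k, hk⟩ => (e k).2.1 (hk ▸ hi : y (c k) = 0))]
      rfl)
    have h0 := congrFun ha i₀
    rw [Function.extend_apply' _ _ _ hi₀c] at h0
    have ha0 : a = 0 := by simpa [hi₀] using h0.symm
    funext k
    have hk := congrFun ha (c k)
    rw [hc.extend_apply] at hk
    simpa [ha0] using hk
  obtain ⟨r, hr, hdet⟩ := exists_det_submatrix_ne_zero M hM
  let r' : Fin s → Fin m := fun k => (r k).1
  have hr' : Function.Injective r' := Subtype.val_injective.comp hr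
  set B : Matrix (Fin s) (Fin s) ℤ := W.submatrix r' c with hB
  have hMB : M.submatrix r id = B.map (Int.castRingHom ℝ) := rfl
  have hdetB : (M.submatrix r id).det = (B.det : ℝ) := by
    rw [hMB]
    exact (RingHom.map_det _ _).symm
  let b : Fin s → ℤ := fun k => -W (r' k) i₀
  let g : Fin n → ℤ := Function.extend c (cramer B b) (Pi.single i₀ B.det)
  have hg₀ : g i₀ = B.det := by
    simp only [g]
    rw [Function.extend_apply' _ _ _ hi₀c, Pi.single_eq_same]
  have hgc : ∀ k, g (c k) = cramer B b k := fun k => hc.extend_apply _ _ _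
  have hgz : ∀ i, i ≠ i₀ → (¬ ∃ k, c k = i) → g i = 0 := by
    intro i hi h
    simp only [g]
    rw [Function.extend_apply' _ _ _ h, Pi.single_eq_of_ne hi]
  have hBy : ∀ k, ∑ l, (B k l : ℝ) * y (c l) = y i₀ * b k := by
    intro k
    have h := (r k).2
    rw [← Finset.add_sum_erase _ _ (Finset.mem_univ i₀)] at h
    have h2 : ∑ l, (B k l : ℝ) * y (c l)
        = ∑ i ∈ Finset.univ.erase i₀, (W (r' k) i : ℝ) * y i := by
      refine Finset.sum_of_injOn c hc.injOn (fun l _ => ?_) (fun i hi hi' => ?_) (fun l _ => rfl)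
      · simpa using hc₀ l
      · rw [hcy i (Finset.ne_of_mem_erase hi) (by simpa using hi'), mul_zero]
    rw [h2]
    push_cast [b]
    linarith
  have hBg : ∀ k, ∑ l, (B k l : ℝ) * (cramer B b l : ℝ) = B.det * b k := by
    intro k
    have h := congrFun (mulVec_cramer B b) k
    simp only [mulVec, dotProduct, Pi.smul_apply, smul_eq_mul] at h
    exact_mod_cast h
  have hprop : ∀ k, y i₀ * (cramer B b k : ℝ) - B.det * y (c k) = 0 := by
    have h := eq_zero_of_mulVec_eq_zero hdet
      (v := fun k => y i₀ * (cramer B b k : ℝ) - B.det * y (c k)) (by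
        funext k
        have h1 : ∑ l, (B k l : ℝ) * (y i₀ * (cramer B b l : ℝ) - B.det * y (c l))
            = y i₀ * ∑ l, (B k l : ℝ) * (cramer B b l : ℝ)
              - B.det * ∑ l, (B k l : ℝ) * y (c l) := by
          rw [Finset.mul_sum, Finset.mul_sum, ← Finset.sum_sub_distrib]
          exact Finset.sum_congr rfl fun l _ => by ring
        rw [hBg, hBy] at h1
        exact h1.trans (by simp only [Pi.zero_apply]; ring))
    exact fun k => congrFun h k
  refine ⟨g, B.det / y i₀, div_ne_zero (hdetB ▸ hdet) hi₀, fun i => ?_, fun i => ?_⟩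
  · rw [div_mul_eq_mul_div, eq_div_iff hi₀]
    by_cases hi : i = i₀
    · rw [hi, hg₀]
    by_cases hk : ∃ k, c k = i
    · obtain ⟨k, rfl⟩ := hk
      rw [hgc]
      linarith [hprop k]
    · rw [hgz i hi hk, hcy i hi hk]
      simp
  · by_cases hi : i = i₀
    · rw [hi, hg₀]
      exact hW s r' c hr' hc
    by_cases hk : ∃ k, c k = i
    · obtain ⟨k, rfl⟩ := hk
      have hcol : B.updateCol k b
          = (W.submatrix r' (Function.update c k i₀)).updateCol k
            ((-1 : ℤ) • fun l => W (r' l) i₀) := by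
        ext p q
        by_cases hq : q = k
        · subst hq
          simp [b]
        · simp [hq, hB]
      have hself : (W.submatrix r' (Function.update c k i₀)).updateCol k (fun l => W (r' l) i₀)
          = W.submatrix r' (Function.update c k i₀) := by
        ext p q
        by_cases hq : q = k
        · subst hq
          simp
        · simp [hq]
      rw [hgc, cramer_apply, hcol, det_updateCol_smul, hself, neg_one_mul, abs_neg]
      refine hW s r' _ hr' fun p q hpq => ?_
      by_cases hp : p = k <;> by_cases hq : q = k
      · rw [hp, hq]
      · simp only [hp, Function.update_self, Function.update_of_ne hq] at hpq
        exact absurd hpq.symm (hc₀ q)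
      · simp only [hq, Function.update_self, Function.update_of_ne hp] at hpq
        exact absurd hpq (hc₀ p)
      · rw [Function.update_of_ne hp, Function.update_of_ne hq] at hpq
        exact hc hpq
    · rw [hgz i hi hk]
      simp

/-- Moving from `u` along `v` until a further entry vanishes, without any sign change. -/
lemma exists_conformal_step {ι : Type*} [Finite ι] {u v : ι → ℝ}
    (huv : ∀ k, u k = 0 → v k = 0) (hv : v ≠ 0) :
    ∃ a : ℝ, (∃ k, v k ≠ 0 ∧ u k - a * v k = 0) ∧
      (∀ k, ∃ t : ℝ, 0 ≤ t ∧ u k - a * v k = t * u k) ∧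
      ((∀ k, ∃ t : ℝ, 0 ≤ t ∧ v k = t * u k) → 0 ≤ a) := by
  obtain ⟨k₀, hk₀⟩ := Function.ne_iff.1 hv
  rw [Pi.zero_apply] at hk₀
  have : Nonempty ι := ⟨k₀⟩
  obtain ⟨k, hk⟩ := Finite.exists_max fun k => |v k / u k|
  have hu₀ : u k₀ ≠ 0 := mt (huv k₀) hk₀
  have hpos : 0 < |v k / u k| := lt_of_lt_of_le (abs_pos.2 (div_ne_zero hk₀ hu₀)) (hk k₀)
  have hne : v k / u k ≠ 0 := abs_pos.1 hpos
  obtain ⟨hvk, huk⟩ := div_ne_zero_iff.1 hne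
  have hv_eq : ∀ j, v j = v j / u j * u j := by
    intro j
    by_cases hj : u j = 0
    · rw [hj, huv j hj]; simp
    · rw [div_mul_cancel₀ _ hj]
  refine ⟨(v k / u k)⁻¹, ⟨k, hvk, ?_⟩, fun j => ⟨1 - (v k / u k)⁻¹ * (v j / u j), ?_, ?_⟩, ?_⟩
  · field_simp
    ring
  · have h : |(v k / u k)⁻¹ * (v j / u j)| ≤ 1 := by
      rw [abs_mul, abs_inv, inv_mul_le_iff₀ hpos, mul_one]
      exact hk j
    linarith [le_abs_self ((v k / u k)⁻¹ * (v j / u j))]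
  · nth_rewrite 1 [hv_eq j]
    ring
  · intro h
    obtain ⟨t, ht, hvt⟩ := h k
    rw [hvt, mul_div_assoc, div_self huk, mul_one]
    exact inv_nonneg.2 ht

/-- Below every nonzero vector, in the conformal order given by an injective linear map,
there is an elementary one. -/
lemma exists_conformal_elementary {V ι : Type*} [AddCommGroup V] [Module ℝ V] [Finite ι]
    {L : V →ₗ[ℝ] ι → ℝ} (hL : Function.Injective L) {y : V} (hy : y ≠ 0) :
    ∃ x, x ≠ 0 ∧ (∀ k, ∃ t : ℝ, 0 ≤ t ∧ L x k = t * L y k) ∧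
      ∀ z, (∀ k, L x k = 0 → L z k = 0) → ∃ a : ℝ, z = a • x := by
  induction hN : {k | L y k ≠ 0}.ncard using Nat.strong_induction_on generalizing y with
  | _ N ih =>
  by_cases hel : ∀ z, (∀ k, L y k = 0 → L z k = 0) → ∃ a : ℝ, z = a • y
  · exact ⟨y, hy, fun k => ⟨1, zero_le_one, (one_mul _).symm⟩, hel⟩
  push Not at hel
  obtain ⟨z, hz, hzy⟩ := hel
  have hz0 : L z ≠ 0 := fun h => hzy 0 (by
    rw [zero_smul]
    exact hL (h.trans (map_zero L).symm))
  obtain ⟨a, ⟨k, hvk, hk⟩, hconf, -⟩ := exists_conformal_step hz hz0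
  have ha : a ≠ 0 := by
    rintro rfl
    exact hvk (hz k (by simpa using hk))
  have hL' : ∀ j, L (y - a • z) j = L y j - a * L z j := by simp
  have hy' : y - a • z ≠ 0 := fun h => hzy a⁻¹ (by
    rw [sub_eq_zero.1 h, smul_smul, inv_mul_cancel₀ ha, one_smul])
  have hlt : {k | L (y - a • z) k ≠ 0}.ncard < N := by
    rw [← hN]
    refine Set.ncard_lt_ncard ⟨fun j hj h0 => hj ?_, fun h => ?_⟩ (Set.toFinite _)
    · rw [hL', h0, hz j h0]; simp
    · exact h (a := k) (mt (hz k) hvk) ((hL' k).trans hk)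
  obtain ⟨x, hx, hxc, hxe⟩ := ih _ hlt hy' rfl
  refine ⟨x, hx, fun j => ?_, hxe⟩
  obtain ⟨t, ht, h1⟩ := hxc j
  obtain ⟨t', ht', h2⟩ := hconf j
  exact ⟨t * t', mul_nonneg ht ht', by rw [h1, hL', h2, mul_assoc]⟩

/-- If below every nonzero vector there is a conformal integer vector of size at most `D`, then
every vector is congruent, modulo twice an integer vector, to a small vector below it. -/
lemma exists_small_conformal_residue {n : ℕ} {ι : Type*} [Finite ι] {D : ℝ}
    {L : (Fin n → ℝ) →ₗ[ℝ] ι → ℝ}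
    (hg : ∀ y : Fin n → ℝ, y ≠ 0 → ∃ g : Fin n → ℤ, L (fun i => (g i : ℝ)) ≠ 0 ∧
      (∀ k, ∃ t : ℝ, 0 ≤ t ∧ L (fun i => (g i : ℝ)) k = t * L y k) ∧ ∀ i, |(g i : ℝ)| ≤ D)
    (hD : 0 ≤ D) (y : Fin n → ℝ) :
    ∃ h : Fin n → ℤ, (∀ k, |L (fun i => y i - 2 * h i) k| ≤ |L y k|) ∧
      ∀ i, |y i - 2 * h i| ≤ 2 * n * D := by
  let K : (Fin n → ℝ) → Submodule ℝ (Fin n → ℝ) := fun y =>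
    ⨅ k : {k // L y k = 0}, LinearMap.ker (LinearMap.proj k.1 ∘ₗ L)
  have hK : ∀ y z, z ∈ K y ↔ ∀ k, L y k = 0 → L z k = 0 := by
    intro y z
    simp [K, Submodule.mem_iInf]
  have hL0 : L (fun _ => 0) = 0 := map_zero L
  suffices H : ∀ (d : ℕ) (y : Fin n → ℝ), finrank ℝ (K y) ≤ d →
      ∃ h : Fin n → ℤ,
        (∀ k, ∃ t : ℝ, 0 ≤ t ∧ t ≤ 1 ∧ L (fun i => y i - 2 * h i) k = t * L y k) ∧
        ∀ i, |y i - 2 * h i| ≤ 2 * d * D by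
    obtain ⟨h, h1, h2⟩ := H n y ((Submodule.finrank_le _).trans_eq (finrank_fin_fun ℝ))
    refine ⟨h, fun k => ?_, h2⟩
    obtain ⟨t, ht0, ht1, ht⟩ := h1 k
    rw [ht, abs_mul, abs_of_nonneg ht0]
    exact mul_le_of_le_one_left (abs_nonneg _) ht1
  intro d
  induction d with
  | zero =>
    intro y hy
    have hbot : K y = ⊥ := Submodule.finrank_eq_zero.1 (Nat.le_zero.1 hy)
    have hy0 : y = 0 := by
      have : y ∈ K y := (hK y y).2 fun _ h => h
      simpa [hbot] using this
    subst hy0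
    exact ⟨0, fun k => ⟨1, zero_le_one, le_rfl, by simp [hL0]⟩, by simp⟩
  | succ d ih =>
    intro y hy
    by_cases hy0 : y = 0
    · subst hy0
      refine ⟨0, fun k => ⟨1, zero_le_one, le_rfl, by simp [hL0]⟩, fun i => ?_⟩
      simp only [Pi.zero_apply, Int.cast_zero, mul_zero, sub_zero, abs_zero]
      positivity
    obtain ⟨g, hg0, hgc, hgD⟩ := hg y hy0
    set γ : Fin n → ℝ := fun i => (g i : ℝ) with hγ
    have hgy : ∀ k, L y k = 0 → L γ k = 0 := by
      intro k hk
      obtain ⟨t, -, ht⟩ := hgc k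
      rw [ht, hk, mul_zero]
    obtain ⟨a, ⟨k₀, hvk, hk₀⟩, hconf, ha⟩ := exists_conformal_step hgy hg0
    replace ha := ha hgc
    have hL' : ∀ j, L (y - a • γ) j = L y j - a * L γ j := by simp
    have hlt : K (y - a • γ) < K y := by
      refine lt_of_le_of_ne (fun z hz => ?_) (fun h => ?_)
      · rw [hK] at hz ⊢
        exact fun k hk => hz k (by rw [hL', hk, hgy k hk]; simp)
      · have h1 : γ ∈ K y := (hK _ _).2 hgy
        rw [← h, hK] at h1
        exact hvk (h1 k₀ ((hL' k₀).trans hk₀))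
    obtain ⟨h, hh, hhD⟩ := ih (y - a • γ) (by
      have := Submodule.finrank_lt_finrank_of_lt hlt
      omega)
    set f : ℤ := ⌊a / 2⌋ with hf
    have hf0 : (0 : ℝ) ≤ f := by
      exact_mod_cast Int.floor_nonneg.2 (by linarith : 0 ≤ a / 2)
    have hf1 : (f : ℝ) ≤ a / 2 := Int.floor_le _
    have hf2 : a / 2 < f + 1 := Int.lt_floor_add_one _
    have hvec : (fun i => y i - 2 * ((h i + f * g i : ℤ) : ℝ))
        = (fun i => (y - a • γ) i - 2 * h i) + (a - 2 * f) • γ := by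
      funext i
      simp only [Pi.add_apply, Pi.sub_apply, Pi.smul_apply, smul_eq_mul, hγ]
      push_cast
      ring
    refine ⟨fun i => h i + f * g i, fun k => ?_, fun i => ?_⟩
    · obtain ⟨t, ht0, ht1, ht⟩ := hh k
      rw [hvec, map_add, map_smul, Pi.add_apply, Pi.smul_apply, smul_eq_mul, ht, hL']
      by_cases hk : L y k = 0
      · exact ⟨1, zero_le_one, le_rfl, by rw [hgy k hk, hk]; ring⟩
      obtain ⟨s, hs0, hs⟩ := hgc k
      obtain ⟨τ, hτ0, hτ⟩ := hconf k
      have hτs : τ = 1 - a * s := by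
        apply mul_right_cancel₀ hk
        rw [← hτ, hs]
        ring
      refine ⟨t * τ + (a - 2 * f) * s, ?_, ?_, ?_⟩
      · have : 0 ≤ (a - 2 * f) * s := mul_nonneg (by linarith) hs0
        positivity
      · nlinarith [mul_nonneg (sub_nonneg.2 ht1) hτ0, mul_nonneg hf0 hs0]
      · rw [hτ, hs]
        ring
    · have hi := congrFun hvec i
      simp only [Pi.add_apply, Pi.smul_apply, smul_eq_mul] at hi
      rw [hi]
      refine (abs_add_le _ _).trans ?_
      have h1 : |(a - 2 * f) * γ i| ≤ 2 * D := by
        rw [abs_mul, abs_of_nonneg (by linarith : 0 ≤ a - 2 * f)]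
        exact mul_le_mul (by linarith) (hgD i) (abs_nonneg _) zero_le_two
      push_cast
      linarith [hhD i]

/-- Below every nonzero vector, conformally with respect to the rows of `W` and the coordinates,
there is a nonzero integer vector bounded by the subdeterminants of `W`. -/
lemma exists_bounded_conformal_int {m n Δ : ℕ} {W : Matrix (Fin m) (Fin n) ℤ}
    (hW : ∀ (s : ℕ) (r : Fin s → Fin m) (c : Fin s → Fin n),
      Function.Injective r → Function.Injective c → |(W.submatrix r c).det| ≤ (Δ : ℤ))
    {L : (Fin n → ℝ) →ₗ[ℝ] (Fin m ⊕ Fin n) → ℝ}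
    (hL₁ : ∀ x j, L x (Sum.inl j) = ∑ i, (W j i : ℝ) * x i)
    (hL₂ : ∀ x i, L x (Sum.inr i) = x i) {y : Fin n → ℝ} (hy : y ≠ 0) :
    ∃ g : Fin n → ℤ, L (fun i => (g i : ℝ)) ≠ 0 ∧
      (∀ k, ∃ t : ℝ, 0 ≤ t ∧ L (fun i => (g i : ℝ)) k = t * L y k) ∧
      ∀ i, |(g i : ℝ)| ≤ (Δ : ℝ) := by
  have hL : Function.Injective L := fun u v huv => funext fun i => by
    rw [← hL₂ u, ← hL₂ v, huv]
  obtain ⟨x, hx, hxc, hxe⟩ := exists_conformal_elementary hL hy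
  obtain ⟨g, a, ha, hga, hgD⟩ := exists_int_multiple_of_elementary hW hx fun z h₁ h₂ => hxe z (by
    rintro (j | i)
    · rw [hL₁, hL₁]
      exact h₁ j
    · rw [hL₂, hL₂]
      exact h₂ i)
  have key : ∀ (g : Fin n → ℤ) (a : ℝ), 0 < a → (∀ i, (g i : ℝ) = a * x i) →
      L (fun i => (g i : ℝ)) ≠ 0 ∧
      ∀ k, ∃ t : ℝ, 0 ≤ t ∧ L (fun i => (g i : ℝ)) k = t * L y k := by
    intro g a ha hga
    have hgx : (fun i => (g i : ℝ)) = a • x := funext hga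
    rw [hgx]
    refine ⟨fun h => smul_ne_zero ha.ne' hx (hL (h.trans (map_zero L).symm)), fun k => ?_⟩
    obtain ⟨t, ht, h⟩ := hxc k
    exact ⟨a * t, mul_nonneg ha.le ht, by
      rw [map_smul, Pi.smul_apply, smul_eq_mul, h, mul_assoc]⟩
  rcases ha.lt_or_gt with hneg | hpos
  · obtain ⟨h1, h2⟩ := key (-g) (-a) (neg_pos.2 hneg) fun i => by
      rw [Pi.neg_apply, Int.cast_neg, hga, neg_mul]
    exact ⟨-g, h1, h2, fun i => by
      rw [Pi.neg_apply, Int.cast_neg, abs_neg]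
      exact_mod_cast hgD i⟩
  · obtain ⟨h1, h2⟩ := key g a hpos hga
    exact ⟨g, h1, h2, fun i => by exact_mod_cast hgD i⟩


/-- proximity result: the midpoint of any two integer points of the polyhedron
`P = {x : Wx ≤ w}` is again the midpoint of two integer points of `P` lying within
`ℓ∞`-distance `nΔ` of it. -/
theorem stmt_5 (m n : ℕ) (hm : 0 < m) (hn : 0 < n) (Δ : ℕ) (hΔ : 0 < Δ)
    (W : Matrix (Fin m) (Fin n) ℤ)
    (hW : ∀ (s : ℕ) (r : Fin s → Fin m) (c : Fin s → Fin n),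
      Function.Injective r → Function.Injective c → |(W.submatrix r c).det| ≤ (Δ : ℤ))
    (w : Fin m → ℤ)
    (P : Set (Fin n → ℝ)) (hP : P = {x | ∀ j, (∑ i, (W j i : ℝ) * x i) ≤ (w j : ℝ)})
    (xl xu : Fin n → ℝ) (hxl : xl ∈ P) (hxu : xu ∈ P)
    (hxlZ : ∀ i, ∃ z : ℤ, xl i = (z : ℝ)) (hxuZ : ∀ i, ∃ z : ℤ, xu i = (z : ℝ))
    (x0 : Fin n → ℝ) (hx0 : x0 = fun i => (xl i + xu i) / 2) :
    ∃ xm xp : Fin n → ℝ, xm ∈ P ∧ xp ∈ P ∧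
      (∀ i, ∃ z : ℤ, xm i = (z : ℝ)) ∧ (∀ i, ∃ z : ℤ, xp i = (z : ℝ)) ∧
      (∀ i, x0 i = (xm i + xp i) / 2) ∧
      (∀ i, |xp i - x0 i| = |x0 i - xm i| ∧ |xp i - x0 i| ≤ (n : ℝ) * (Δ : ℝ)) := by
  subst hP hx0
  let L : (Fin n → ℝ) →ₗ[ℝ] (Fin m ⊕ Fin n) → ℝ :=
    (fromRows (W.map (Int.cast : ℤ → ℝ)) 1).mulVecLin
  have hL₁ : ∀ x j, L x (Sum.inl j) = ∑ i, (W j i : ℝ) * x i := fun x j => by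
    simp [L, mulVec, dotProduct]
  have hL₂ : ∀ x i, L x (Sum.inr i) = x i := fun x i => by
    simp [L, fromRows_mulVec]
  obtain ⟨h, hh, hhD⟩ := exists_small_conformal_residue (D := (Δ : ℝ))
    (fun y hy => exists_bounded_conformal_int hW hL₁ hL₂ hy) Δ.cast_nonneg (fun i => xu i - xl i)
  have hrow : ∀ j, |(∑ i, (W j i : ℝ) * xu i) - (∑ i, (W j i : ℝ) * xl i)
      - 2 * ∑ i, (W j i : ℝ) * h i|
      ≤ |(∑ i, (W j i : ℝ) * xu i) - ∑ i, (W j i : ℝ) * xl i| := by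
    intro j
    have := hh (Sum.inl j)
    simp only [hL₁, mul_sub, Finset.sum_sub_distrib, mul_left_comm _ (2 : ℝ),
      ← Finset.mul_sum] at this
    exact this
  refine ⟨fun i => xl i + h i, fun i => xu i - h i, fun j => ?_, fun j => ?_, fun i => ?_,
    fun i => ?_, fun i => by ring, fun i => ⟨by congr 1; ring, ?_⟩⟩
  · have h1 := hxl j
    have h2 := hxu j
    have h3 := abs_le.1 (hrow j)
    simp only [mul_add, Finset.sum_add_distrib]
    rcases abs_cases ((∑ i, (W j i : ℝ) * xu i) - ∑ i, (W j i : ℝ) * xl i) with h4 | h4 <;>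
      linarith [h3.1, h3.2]
  · have h1 := hxl j
    have h2 := hxu j
    have h3 := abs_le.1 (hrow j)
    simp only [mul_sub, Finset.sum_sub_distrib]
    rcases abs_cases ((∑ i, (W j i : ℝ) * xu i) - ∑ i, (W j i : ℝ) * xl i) with h4 | h4 <;>
      linarith [h3.1, h3.2]
  · obtain ⟨z, hz⟩ := hxlZ i
    exact ⟨z + h i, by push_cast; rw [hz]⟩
  · obtain ⟨z, hz⟩ := hxuZ i
    exact ⟨z - h i, by push_cast; rw [hz]⟩
  · have h1 := abs_le.1 (hhD i)
    rw [abs_le]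
    constructor <;> linarith [h1.1, h1.2]
end

section
/- Let W ∈ ℤ^{m×n} be a matrix all of whose square submatrices have determinant of absolute value at most Δ, where Δ is a positive integer. Partition the rows of W into two row submatrices W₁ and W₂, and let T = {x ∈ ℝⁿ : W₁x ≤ 0, W₂x ≥ 0}. Then there exists a finite set V ⊆ T ∩ ℤⁿ with |v_i| ≤ Δ for every v ∈ V and every i = 1,…,n, such that every x ∈ T can be written as x = Σ_{v∈V} λ_v v with λ_v ≥ 0 for all v ∈ V. -/
/-- From a point `x` of a polyhedral cone one can move in a direction `y`, annihilated by every
constraint tight at `x` and leaving the cone, until a further constraint becomes tight. -/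
lemma exists_pos_add_smul_mem_cone {ι E : Type*} [Fintype ι] [AddCommGroup E] [Module ℝ E]
    (f : ι → E →ₗ[ℝ] ℝ) {x y : E} (hx : ∀ j, 0 ≤ f j x) (hxy : ∀ j, f j x = 0 → f j y = 0)
    (hy : ∃ j, f j y < 0) :
    ∃ t : ℝ, 0 < t ∧ (∀ j, 0 ≤ f j (x + t • y)) ∧ (∀ j, f j x = 0 → f j (x + t • y) = 0) ∧
      ∃ j, f j x ≠ 0 ∧ f j (x + t • y) = 0 := by
  classical
  obtain ⟨j₀, hj₀, hmin⟩ := Finset.exists_min_image (Finset.univ.filter fun j => f j y < 0)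
    (fun j => f j x / -f j y) (by simpa [Finset.Nonempty] using hy)
  simp only [Finset.mem_filter, Finset.mem_univ, true_and] at hj₀ hmin
  have hxj₀ : f j₀ x ≠ 0 := fun h => hj₀.ne (hxy _ h)
  have ht : 0 < f j₀ x / -f j₀ y :=
    div_pos (lt_of_le_of_ne (hx _) hxj₀.symm) (neg_pos.2 hj₀)
  refine ⟨f j₀ x / -f j₀ y, ht, fun j => ?_, fun j hj => ?_, j₀, hxj₀, ?_⟩
  · rw [map_add, map_smul, smul_eq_mul]
    rcases lt_or_ge (f j y) 0 with hj | hj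
    · have := (le_div_iff₀ (neg_pos.2 hj)).1 (hmin j hj)
      linarith
    · have := mul_nonneg ht.le hj
      linarith [hx j]
  · simp [hj, hxy j hj]
  · rw [map_add, map_smul, smul_eq_mul]
    field_simp [hj₀.ne]
    ring

/-- A pointed polyhedral cone is contained in every convex cone containing its extreme rays. -/
lemma mem_of_extreme_rays_mem {ι E : Type*} [Fintype ι] [AddCommGroup E] [Module ℝ E]
    (f : ι → E →ₗ[ℝ] ℝ) (hf : ∀ x, (∀ j, f j x = 0) → x = 0) (P : PointedCone ℝ E)
    (hP : ∀ x, x ≠ 0 → (∀ j, 0 ≤ f j x) →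
      (∀ y, (∀ j, f j x = 0 → f j y = 0) → ∃ c : ℝ, y = c • x) → x ∈ P)
    (x : E) (hx : ∀ j, 0 ≤ f j x) : x ∈ P := by
  classical
  induction hN : (Finset.univ.filter fun j => f j x ≠ 0).card using Nat.strong_induction_on
    generalizing x with
  | _ N ih =>
  have step : ∀ z, (∀ j, 0 ≤ f j z) → (∀ j, f j x = 0 → f j z = 0) →
      (∃ j, f j x ≠ 0 ∧ f j z = 0) → z ∈ P := by
    rintro z hz hxz ⟨j, hj, hj'⟩
    refine ih _ ?_ z hz rfl
    rw [← hN]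
    apply Finset.card_lt_card
    refine (Finset.ssubset_iff_of_subset fun i hi => ?_).2 ⟨j, by simpa using hj, by simpa using hj'⟩
    simp only [Finset.mem_filter, Finset.mem_univ, true_and] at hi ⊢
    exact fun h => hi (hxz i h)
  have smul_mem : ∀ {z : E} {t : ℝ}, 0 ≤ t → z ∈ P → t • z ∈ P := fun ht hz =>
    P.smul_mem ht hz
  by_cases hx0 : x = 0
  · rw [hx0]; exact P.zero_mem
  by_cases hext : ∀ y, (∀ j, f j x = 0 → f j y = 0) → ∃ c : ℝ, y = c • x
  · exact hP x hx0 hx hext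
  push Not at hext
  obtain ⟨y, hxy, hy⟩ := hext
  obtain ⟨j₀, hj₀⟩ : ∃ j, f j x ≠ 0 := by
    by_contra! h
    exact hx0 (hf x h)
  obtain ⟨w, hw0, hxw, hwj⟩ : ∃ w, w ≠ 0 ∧ (∀ j, f j x = 0 → f j w = 0) ∧ f j₀ w = 0 :=
    ⟨y - (f j₀ y / f j₀ x) • x, sub_ne_zero.2 (hy _), fun j hj => by simp [hj, hxy j hj],
      by simp [hj₀]⟩
  have hxw' : ∀ j, f j x = 0 → f j (-w) = 0 := fun j hj => by simp [hxw j hj]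
  by_cases hneg : ∃ j, f j w < 0
  · obtain ⟨t, ht, h1, h2, h3⟩ := exists_pos_add_smul_mem_cone f hx hxw hneg
    have ha := step _ h1 h2 h3
    by_cases hpos : ∃ j, f j (-w) < 0
    · obtain ⟨s, hs, h1, h2, h3⟩ := exists_pos_add_smul_mem_cone f hx hxw' hpos
      have hb := step _ h1 h2 h3
      have hst : s + t ≠ 0 := by positivity
      have : x = (s + t)⁻¹ • (s • (x + t • w) + t • (x + s • -w)) := by
        rw [eq_inv_smul_iff₀ hst]
        module
      rw [this]
      exact smul_mem (by positivity) (P.add_mem (smul_mem hs.le ha) (smul_mem ht.le hb))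
    · push Not at hpos
      have hb := step _ hpos hxw' ⟨j₀, hj₀, by simp [hwj]⟩
      have : x = (x + t • w) + t • -w := by module
      rw [this]
      exact P.add_mem ha (smul_mem ht.le hb)
  · push Not at hneg
    have ha := step _ hneg hxw ⟨j₀, hj₀, hwj⟩
    obtain ⟨s, hs, h1, h2, h3⟩ := exists_pos_add_smul_mem_cone f hx hxw' (by
      by_contra! h
      exact hw0 (hf w fun j => le_antisymm (by simpa using h j) (hneg j)))
    have hb := step _ h1 h2 h3
    have : x = (x + s • -w) + s • w := by module
    rw [this]
    exact P.add_mem hb (smul_mem hs.le ha)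

/-- If the kernel of an integer matrix with `k + 1` columns is spanned by `x`, then `x` is
proportional to the vector of signed maximal minors of some `k` distinct rows. -/
lemma exists_signed_minors_eq_smul {ι : Type*} [Fintype ι] {k : ℕ}
    (A : Matrix ι (Fin (k + 1)) ℤ) {x : Fin (k + 1) → ℝ} (hx0 : x ≠ 0)
    (hx : (A.map (Int.cast : ℤ → ℝ)).mulVec x = 0)
    (hker : ∀ y, (A.map (Int.cast : ℤ → ℝ)).mulVec y = 0 → ∃ c : ℝ, y = c • x) :
    ∃ r : Fin k → ι, Function.Injective r ∧ ∃ c : ℝ, c ≠ 0 ∧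
      ∀ i : Fin (k + 1),
        (((-1) ^ (i : ℕ) * (A.submatrix r i.succAbove).det : ℤ) : ℝ) = c * x i := by
  classical
  set B : Matrix ι (Fin (k + 1)) ℝ := A.map Int.cast with hB
  have hrank : B.rank = k := by
    have h1 : Module.finrank ℝ (LinearMap.ker B.mulVecLin) = 1 := by
      refine (finrank_eq_one_iff_of_nonzero' (⟨x, by simpa using hx⟩ : LinearMap.ker B.mulVecLin)
        (by simpa using hx0)).2 ?_
      rintro ⟨y, hy⟩
      obtain ⟨c, hc⟩ := hker y (by simpa using hy)
      exact ⟨c, by ext1; simp [hc]⟩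
    have h2 := B.mulVecLin.finrank_range_add_finrank_ker
    rw [h1, Module.finrank_fin_fun] at h2
    simpa [Matrix.rank] using h2
  obtain ⟨g, hg, hspan, hli⟩ : ∃ g : Fin k → Fin (k + 1) → ℝ, (∀ i, g i ∈ Set.range B.row) ∧
      Submodule.span ℝ (Set.range g) = Submodule.span ℝ (Set.range B.row) ∧
      LinearIndependent ℝ g := by
    have h := Submodule.exists_fun_fin_finrank_span_eq ℝ (Set.range B.row)
    rw [← Matrix.rank_eq_finrank_span_row, hrank] at h
    exact h
  choose r hr using hg
  have hrinj : Function.Injective r := fun a b hab => hli.injective (by rw [← hr, ← hr, hab])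
  have hkerr : ∀ y : Fin (k + 1) → ℝ, (∀ i, B (r i) ⬝ᵥ y = 0) → B.mulVec y = 0 := by
    intro y hy
    ext j
    have hle : Submodule.span ℝ (Set.range g) ≤
        LinearMap.ker ((dotProductBilin ℝ ℝ).flip y) := by
      rw [Submodule.span_le]
      rintro _ ⟨i, rfl⟩
      rw [← hr]
      exact hy i
    rw [hspan] at hle
    exact hle (Submodule.subset_span ⟨j, rfl⟩)
  have laplace : ∀ u : Fin (k + 1) → ℝ,
      (Matrix.of (Fin.cons u fun i => B (r i)) : Matrix (Fin (k + 1)) (Fin (k + 1)) ℝ).det =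
        u ⬝ᵥ fun i => (((-1) ^ (i : ℕ) * (A.submatrix r i.succAbove).det : ℤ) : ℝ) := by
    intro u
    rw [Matrix.det_succ_row_zero, dotProduct]
    refine Finset.sum_congr rfl fun i _ => ?_
    have : ((A.submatrix r i.succAbove).det : ℝ) =
        ((Matrix.of (Fin.cons u fun i => B (r i)) :
          Matrix (Fin (k + 1)) (Fin (k + 1)) ℝ).submatrix Fin.succ i.succAbove).det := by
      rw [Int.cast_det]
      rfl
    rw [Int.cast_mul, this]
    simp only [Matrix.of_apply, Fin.cons_zero, Int.cast_pow, Int.cast_neg, Int.cast_one]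
    ring
  obtain ⟨c, hc⟩ := hker _ (hkerr (fun i => (((-1) ^ (i : ℕ) *
      (A.submatrix r i.succAbove).det : ℤ) : ℝ)) fun i => by
    rw [← laplace]
    exact Matrix.det_zero_of_row_eq (i := 0) (j := i.succ) (Fin.succ_ne_zero i).symm (by
      ext; simp))
  refine ⟨r, hrinj, c, ?_, fun i => congrFun hc i⟩
  rintro rfl
  obtain ⟨y, hy0, hy⟩ := Matrix.exists_mulVec_eq_zero_iff.2
    ((laplace x).trans (by rw [hc]; simp))
  obtain ⟨d, rfl⟩ := hker y (hkerr y fun i => by simpa [Matrix.mulVec] using congrFun hy i.succ)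
  have h0 : x ⬝ᵥ (d • x) = 0 := by simpa [Matrix.mulVec] using congrFun hy 0
  rw [dotProduct_smul, smul_eq_mul, mul_eq_zero, dotProduct_self_eq_zero] at h0
  rcases h0 with rfl | h0
  · simp at hy0
  · exact hx0 h0

/-- If the vectors with support in that of `x` and annihilated by the rows of `W` that annihilate
`x` are the multiples of `x`, then `x` is a positive multiple of an integer vector bounded by the
subdeterminants of `W`. -/
lemma exists_int_eq_pos_smul {m n : ℕ} {Δ : ℤ} (W : Matrix (Fin m) (Fin n) ℤ) (hΔ : 0 ≤ Δ)
    (hW : ∀ (s : ℕ) (r : Fin s → Fin m) (c : Fin s → Fin n),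
      Function.Injective r → Function.Injective c → |(W.submatrix r c).det| ≤ Δ)
    {x : Fin n → ℝ} (hx0 : x ≠ 0)
    (hext : ∀ y : Fin n → ℝ, (∀ i, x i = 0 → y i = 0) →
      (∀ j, ∑ i, (W j i : ℝ) * x i = 0 → ∑ i, (W j i : ℝ) * y i = 0) → ∃ c : ℝ, y = c • x) :
    ∃ v : Fin n → ℤ, (∀ i, |v i| ≤ Δ) ∧ ∃ c : ℝ, 0 < c ∧ ∀ i, (v i : ℝ) = c * x i := by
  classical
  suffices h : ∃ v : Fin n → ℤ, (∀ i, |v i| ≤ Δ) ∧ ∃ c : ℝ, c ≠ 0 ∧ ∀ i, (v i : ℝ) = c * x i by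
    obtain ⟨v, hv, c, hc, hvx⟩ := h
    rcases hc.lt_or_gt with hc | hc
    · exact ⟨-v, fun i => by simpa using hv i, -c, neg_pos.2 hc, fun i => by simp [hvx]⟩
    · exact ⟨v, hv, c, hc, hvx⟩
  set S : Finset (Fin n) := Finset.univ.filter fun i => x i ≠ 0 with hS
  have hSmem : ∀ i, i ∈ S ↔ x i ≠ 0 := by simp [hS]
  obtain ⟨i₀, hi₀⟩ := Function.ne_iff.1 hx0
  obtain ⟨k, hk⟩ : ∃ k, S.card = k + 1 :=
    Nat.exists_eq_succ_of_ne_zero (Finset.card_ne_zero_of_mem ((hSmem i₀).2 hi₀))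
  let e : Fin (k + 1) ≃ S := (S.equivFinOfCardEq hk).symm
  let extend : (Fin (k + 1) → ℝ) → Fin n → ℝ := fun y i =>
    if h : i ∈ S then y (e.symm ⟨i, h⟩) else 0
  have sum_eq : ∀ (a y : Fin n → ℝ), (∀ i, x i = 0 → y i = 0) →
      ∑ l, a (e l) * y (e l) = ∑ i, a i * y i := by
    intro a y hy
    rw [Equiv.sum_comp e fun i : S => a i * y i, Finset.sum_coe_sort S fun i => a i * y i]
    refine Finset.sum_subset (Finset.subset_univ _) fun i _ hi => ?_
    rw [hy i (by simpa [hSmem] using hi), mul_zero]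
  let A : Matrix {j : Fin m // ∑ i, (W j i : ℝ) * x i = 0} (Fin (k + 1)) ℤ :=
    W.submatrix Subtype.val fun l => (e l : Fin n)
  obtain ⟨r, hr, c, hc, hrc⟩ := exists_signed_minors_eq_smul A (x := fun l => x (e l))
    (Function.ne_iff.2 ⟨e.symm ⟨i₀, (hSmem i₀).2 hi₀⟩, by simpa using hi₀⟩)
    (by
      ext j
      exact (sum_eq (fun i => (W j i : ℝ)) x fun _ h => h).trans j.2)
    (by
      intro y hy
      have hext0 : ∀ i, x i = 0 → extend y i = 0 := fun i hi => by simp [extend, hSmem, hi]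
      have hexte : ∀ l, extend y (e l) = y l := fun l => by simp [extend]
      obtain ⟨c, hc⟩ := hext (extend y) hext0 fun j hj => by
        rw [← sum_eq (fun i => (W j i : ℝ)) _ hext0]
        simp only [hexte]
        exact congrFun hy ⟨j, hj⟩
      exact ⟨c, funext fun l => by rw [← hexte, hc]; rfl⟩)
  refine ⟨fun i => if h : i ∈ S then (-1) ^ (e.symm ⟨i, h⟩ : ℕ) *
    (A.submatrix r (e.symm ⟨i, h⟩).succAbove).det else 0, fun i => ?_, c, hc, fun i => ?_⟩
  · by_cases h : i ∈ S
    · simp only [h, dif_pos, abs_mul, abs_pow, abs_neg, abs_one, one_pow, one_mul]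
      exact hW k (fun a => (r a).1) (fun b => (e ((e.symm ⟨i, h⟩).succAbove b) : Fin n))
        (Subtype.val_injective.comp hr)
        (Subtype.val_injective.comp (e.injective.comp Fin.succAbove_right_injective))
    · simpa [h] using hΔ
  · by_cases h : i ∈ S
    · simp only [h, dif_pos]
      rw [hrc]
      simp
    · have hxi : x i = 0 := by simpa [hSmem] using h
      simp [h, hxi]


/-- a polyhedral cone cut out by sign constraints on an integer matrix with
subdeterminants bounded by `Δ` is finitely generated by integer vectors whose components are
bounded by `Δ` in absolute value. -/
theorem stmt_7 (m n : ℕ) (Δ : ℕ) (hΔ : 0 < Δ)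
    (W : Matrix (Fin m) (Fin n) ℤ)
    (hW : ∀ (s : ℕ) (r : Fin s → Fin m) (c : Fin s → Fin n),
      Function.Injective r → Function.Injective c → |(W.submatrix r c).det| ≤ (Δ : ℤ))
    (p : Fin m → Prop)
    (T : Set (Fin n → ℝ))
    (hT : T = {x | ∀ j, (p j → (∑ i, (W j i : ℝ) * x i) ≤ 0) ∧
                        (¬ p j → 0 ≤ ∑ i, (W j i : ℝ) * x i)}) :
    ∃ V : Finset (Fin n → ℤ),
      (∀ v ∈ V, (fun i => ((v i : ℝ))) ∈ T ∧ ∀ i, |v i| ≤ (Δ : ℤ)) ∧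
      ∀ x ∈ T, ∃ lam : (Fin n → ℤ) → ℝ, (∀ v ∈ V, 0 ≤ lam v) ∧
        ∀ i, x i = ∑ v ∈ V, lam v * (v i : ℝ) := by
  classical
  subst hT
  let toReal : (Fin n → ℤ) → Fin n → ℝ := fun v i => (v i : ℝ)
  let V : Finset (Fin n → ℤ) := (Fintype.piFinset fun _ => Finset.Icc (-(Δ : ℤ)) Δ).filter
    fun v => toReal v ∈ {x : Fin n → ℝ | ∀ j, (p j → (∑ i, (W j i : ℝ) * x i) ≤ 0) ∧
      (¬ p j → 0 ≤ ∑ i, (W j i : ℝ) * x i)}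
  refine ⟨V, fun v hv => ?_, fun x₀ hx₀ => ?_⟩
  · simp only [V, Finset.mem_filter, Fintype.mem_piFinset, Finset.mem_Icc] at hv
    exact ⟨hv.2, fun i => abs_le.2 (hv.1 i)⟩
  let rowSign : Fin m → ℝ := fun j => if p j then -1 else 1
  let colSign : Fin n → ℝ := fun i => if x₀ i < 0 then -1 else 1
  have hrow0 : ∀ j, rowSign j ≠ 0 := fun j => by dsimp only [rowSign]; split_ifs <;> norm_num
  have hcol0 : ∀ i, colSign i ≠ 0 := fun i => by dsimp only [colSign]; split_ifs <;> norm_num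
  let f : Fin m ⊕ Fin n → (Fin n → ℝ) →ₗ[ℝ] ℝ := Sum.elim
    (fun j => rowSign j • (dotProductBilin ℝ ℝ fun i => (W j i : ℝ)))
    (fun i => colSign i • LinearMap.proj i)
  have hfl : ∀ j x, f (.inl j) x = rowSign j * ∑ i, (W j i : ℝ) * x i := fun _ _ => rfl
  have hfr : ∀ i x, f (.inr i) x = colSign i * x i := fun _ _ => rfl
  have hrow : ∀ j (x : Fin n → ℝ), 0 ≤ f (.inl j) x ↔
      (p j → (∑ i, (W j i : ℝ) * x i) ≤ 0) ∧ (¬ p j → 0 ≤ ∑ i, (W j i : ℝ) * x i) := by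
    intro j x
    by_cases h : p j <;> simp [hfl, rowSign, h]
  have hmem : x₀ ∈ PointedCone.hull ℝ (toReal '' (V : Set (Fin n → ℤ))) := by
    refine mem_of_extreme_rays_mem f (fun x hx => ?_) _ (fun x hx0 hx hext => ?_) x₀ ?_
    · ext i
      simpa [hfr, hcol0] using hx (.inr i)
    · obtain ⟨v, hv, c, hc, hvx⟩ := exists_int_eq_pos_smul W (Int.natCast_nonneg Δ) hW hx0
        fun y hy1 hy2 => hext y (by
          rintro (j | i) h
          · simpa [hfl, hrow0] using hy2 j (by simpa [hfl, hrow0] using h)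
          · simpa [hfr, hcol0] using hy1 i (by simpa [hfr, hcol0] using h))
      have hv' : toReal v = c • x := funext hvx
      have hvV : v ∈ V := by
        simp only [V, Finset.mem_filter, Fintype.mem_piFinset, Finset.mem_Icc]
        refine ⟨fun i => abs_le.1 (hv i), fun j => (hrow j _).1 ?_⟩
        rw [hv', map_smul]
        exact mul_nonneg hc.le (hx _)
      rw [show x = c⁻¹ • toReal v by rw [hv', inv_smul_smul₀ hc.ne']]
      exact PointedCone.smul_mem _ (inv_nonneg.2 hc.le) (Submodule.subset_span ⟨v, hvV, rfl⟩)
    · rintro (j | i)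
      · exact (hrow j x₀).2 (hx₀ j)
      · rw [hfr]
        dsimp only [colSign]
        split_ifs <;> linarith
  obtain ⟨lam, hlam⟩ := (Submodule.mem_span_image_finset_iff_exists_fun' _).1 hmem
  refine ⟨fun v => lam v, fun v _ => (lam v).2, fun i => ?_⟩
  rw [← hlam, Finset.sum_apply]
  rfl
end

section
/- Let k ≤ n and m be positive integers, let Δ be a positive integer, let W ∈ ℤ^{m×n} have all square-submatrix determinants of absolute value at most Δ, and let w ∈ ℤᵐ. Let S = {x ∈ ℤⁿ : Wx ≤ w}, let q₁,…,q_k > 0 and h ∈ ℝⁿ, and define f(x) = Σ_{i=1}^k (−q_i x_i²) + Σ_{i=1}^n h_i x_i. For each i = 1,…,k suppose l_i = min{x_i : x ∈ S} and u_i = max{x_i : x ∈ S} exist, let g > 0 be a real number with u_i − l_i ≥ g for all i = 1,…,k, and let γ = max{q_i(u_i − l_i)² : i = 1,…,k}, attained at an index i₀. Let x^l, x^u ∈ S with x^l_{i₀} = l_{i₀} and x^u_{i₀} = u_{i₀}, and let x∘ = (x^l + x^u)/2. Then there exists x^Υ ∈ S with f(x∘) − f(x^Υ) ≤ γ k (nΔ)²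 / g². -/
/-- `y` is conformal to `x`: it has no entry of sign opposite to that of `x`, and it vanishes
wherever `x` does. -/
def SignConformal {ι : Type*} (y x : ι → ℝ) : Prop :=
  ∀ a, (0 ≤ x a → 0 ≤ y a) ∧ (x a ≤ 0 → y a ≤ 0)

namespace SignConformal

variable {ι : Type*} {x y z : ι → ℝ}

theorem refl (x : ι → ℝ) : SignConformal x x := fun _ => ⟨id, id⟩

theorem trans (h₁ : SignConformal z y) (h₂ : SignConformal y x) : SignConformal z x :=
  fun a => ⟨fun h => (h₁ a).1 ((h₂ a).1 h), fun h => (h₁ a).2 ((h₂ a).2 h)⟩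

theorem eq_zero (h : SignConformal y x) {a : ι} (ha : x a = 0) : y a = 0 :=
  le_antisymm ((h a).2 ha.le) ((h a).1 ha.ge)

theorem zero (x : ι → ℝ) : SignConformal 0 x := fun _ => ⟨fun _ => le_rfl, fun _ => le_rfl⟩

theorem smul_of_nonneg {c : ℝ} (hc : 0 ≤ c) (x : ι → ℝ) : SignConformal (c • x) x :=
  fun _ => ⟨fun h => mul_nonneg hc h, fun h => mul_nonpos_of_nonneg_of_nonpos hc h⟩

/-- Moving from `x` along a nonzero direction supported on the support of `x`, one can reach a
vector conformal to `x` with strictly smaller support. -/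
theorem exists_sub_smul [Finite ι] (hz : z ≠ 0) (hsupp : ∀ a, x a = 0 → z a = 0) :
    ∃ t : ℝ, (SignConformal z x → 0 ≤ t) ∧ SignConformal (x - t • z) x ∧
      ∃ a, x a ≠ 0 ∧ z a ≠ 0 ∧ (x - t • z) a = 0 := by
  obtain ⟨b, hb⟩ := Function.ne_iff.mp hz
  have : Nonempty ι := ⟨b⟩
  obtain ⟨a, ha⟩ := Finite.exists_max fun a => |z a / x a|
  have hxb : x b ≠ 0 := fun h => hb (hsupp b h)
  have hza : z a / x a ≠ 0 := by
    rw [← abs_pos]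
    exact (abs_pos.mpr (div_ne_zero hb hxb)).trans_le (ha b)
  have hz' : z a ≠ 0 := fun h => hza (by simp [h])
  have hx' : x a ≠ 0 := fun h => hza (by simp [h])
  have key : ∀ c, ∃ s : ℝ, 0 ≤ s ∧ (x - (x a / z a) • z) c = s * x c := by
    intro c
    by_cases hc : x c = 0
    · exact ⟨0, le_rfl, by simp [hc, hsupp c hc]⟩
    · refine ⟨1 - (z c / x c) / (z a / x a), ?_, ?_⟩
      · have h1 : |(z c / x c) / (z a / x a)| ≤ 1 := by
          rw [abs_div, div_le_one (abs_pos.mpr hza)]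
          exact ha c
        linarith [le_abs_self ((z c / x c) / (z a / x a))]
      · simp only [Pi.sub_apply, Pi.smul_apply, smul_eq_mul]
        field_simp
  refine ⟨x a / z a, fun h => ?_, fun c => ?_, a, hx', hz', ?_⟩
  · rcases le_total 0 (x a) with h0 | h0
    · exact div_nonneg h0 ((h a).1 h0)
    · exact div_nonneg_of_nonpos h0 ((h a).2 h0)
  · obtain ⟨s, hs, he⟩ := key c
    rw [he]
    exact ⟨fun h => mul_nonneg hs h, fun h => mul_nonpos_of_nonneg_of_nonpos hs h⟩
  · simp [hz']

end SignConformal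

section Elementary

variable {V ι : Type*} [AddCommGroup V] [Module ℝ V]

/-- The vectors `z` such that `A z` vanishes wherever `A y` does. -/
def supportSpace (A : V →ₗ[ℝ] ι → ℝ) (y : V) : Submodule ℝ V where
  carrier := {z | ∀ a, A y a = 0 → A z a = 0}
  add_mem' hx hz a ha := by simp [hx a ha, hz a ha]
  zero_mem' a _ := by simp
  smul_mem' c z hz a ha := by simp [hz a ha]

theorem mem_supportSpace {A : V →ₗ[ℝ] ι → ℝ} {y z : V} :
    z ∈ supportSpace A y ↔ ∀ a, A y a = 0 → A z a = 0 := Iff.rfl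

/-- Every nonzero vector has a nonzero vector of minimal support conformal to it. -/
theorem exists_conformal_elementary_s8 [Finite ι] (A : V →ₗ[ℝ] ι → ℝ) (hA : Function.Injective A)
    (y : V) (hy : y ≠ 0) :
    ∃ v, v ≠ 0 ∧ SignConformal (A v) (A y) ∧ ∀ z ∈ supportSpace A v, ∃ c : ℝ, z = c • v := by
  induction hN : (Function.support (A y)).ncard using Nat.strong_induction_on generalizing y with
  | _ N ih =>
    by_cases hall : ∀ z ∈ supportSpace A y, ∃ c : ℝ, z = c • y
    · exact ⟨y, hy, SignConformal.refl _, hall⟩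
    push Not at hall
    obtain ⟨z, hz, hzy⟩ := hall
    have hAz : A z ≠ 0 := by
      intro h
      exact hzy 0 (by rw [zero_smul]; exact hA (by rw [h, map_zero]))
    obtain ⟨t, -, hconf, a, hxa, hza, h0⟩ := SignConformal.exists_sub_smul hAz hz
    rw [← map_smul, ← map_sub] at hconf h0
    have hne : y - t • z ≠ 0 := by
      intro h
      rw [sub_eq_zero] at h
      have ht : t ≠ 0 := fun h' => hy (by rw [h, h', zero_smul])
      exact hzy t⁻¹ (by rw [h, smul_smul, inv_mul_cancel₀ ht, one_smul])
    have hlt : (Function.support (A (y - t • z))).ncard < N := by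
      rw [← hN]
      refine Set.ncard_lt_ncard ⟨fun b hb hb' => hb (hconf.eq_zero hb'), fun hsub => ?_⟩
        (Set.toFinite _)
      exact hsub hxa h0
    obtain ⟨v, hv, hvc, hvs⟩ := ih _ hlt _ hne rfl
    exact ⟨v, hv, hvc.trans hconf, hvs⟩

/-- If every nonzero vector has a nonzero conformal vector in `G`, then every vector is a conformal
conic combination of as many elements of `G` as the dimension of its support space. -/
theorem exists_conformal_decomposition [Finite ι] [FiniteDimensional ℝ V]
    (A : V →ₗ[ℝ] ι → ℝ) (hA : Function.Injective A) (G : Set V) (hG0 : (0 : V) ∈ G)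
    (hG : ∀ y, y ≠ 0 → ∃ v ∈ G, v ≠ 0 ∧ SignConformal (A v) (A y)) (d : ℕ) (y : V)
    (hd : Module.finrank ℝ (supportSpace A y) ≤ d) :
    ∃ (α : Fin d → ℝ) (v : Fin d → V), (∀ j, 0 ≤ α j) ∧ (∀ j, v j ∈ G) ∧
      (∀ j, SignConformal (A (v j)) (A y)) ∧ y = ∑ j, α j • v j := by
  induction d generalizing y with
  | zero =>
    have hbot : supportSpace A y = ⊥ := Submodule.finrank_eq_zero.mp (Nat.le_zero.mp hd)
    have hy : y ∈ supportSpace A y := fun _ h => h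
    rw [hbot, Submodule.mem_bot] at hy
    exact ⟨0, 0, fun j => j.elim0, fun j => j.elim0, fun j => j.elim0, by simp [hy]⟩
  | succ d ih =>
    by_cases hy : y = 0
    · exact ⟨0, 0, fun _ => le_rfl, fun _ => hG0, fun _ => by simpa using SignConformal.zero _,
        by simp [hy]⟩
    obtain ⟨v, hvG, hv, hvc⟩ := hG y hy
    have hAv : A v ≠ 0 := fun h => hv (hA (by rw [h, map_zero]))
    obtain ⟨t, ht, hconf, a, hxa, hza, h0⟩ :=
      SignConformal.exists_sub_smul hAv fun a => hvc.eq_zero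
    rw [← map_smul, ← map_sub] at hconf h0
    have hlt : supportSpace A (y - t • v) < supportSpace A y := by
      refine lt_of_le_of_ne (fun z hz b hb => hz b (hconf.eq_zero hb)) fun heq => ?_
      have : v ∈ supportSpace A (y - t • v) := by
        rw [heq]
        exact fun b => hvc.eq_zero
      exact hza (this a h0)
    obtain ⟨α, u, hα, hu, huc, hsum⟩ := ih (y - t • v)
      (Nat.lt_succ_iff.mp ((Submodule.finrank_lt_finrank_of_lt hlt).trans_le hd))
    refine ⟨Fin.cons t α, Fin.cons v u, Fin.cases (ht hvc) hα, Fin.cases hvG hu,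
      Fin.cases hvc fun j => (huc j).trans hconf, ?_⟩
    rw [Fin.sum_univ_succ]
    simp only [Fin.cons_zero, Fin.cons_succ]
    rw [← hsum]
    abel

end Elementary

/-- The alternating maximal minors of a `p × (p + 1)` matrix form a vector of its kernel. -/
theorem Matrix.sum_mul_minor_eq_zero {R : Type*} [CommRing R] {p : ℕ}
    (M : Matrix (Fin p) (Fin (p + 1)) R) (i : Fin p) :
    ∑ k, M i k * ((-1) ^ (k : ℕ) * (M.submatrix id k.succAbove).det) = 0 := by
  let N := M.submatrix (Fin.cons i id : Fin (p + 1) → Fin p) id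
  have h0 : N.det = 0 :=
    Matrix.det_zero_of_row_eq (Fin.succ_ne_zero i).symm (by ext; simp [N])
  rw [Matrix.det_succ_row_zero] at h0
  rw [← h0]
  refine Finset.sum_congr rfl fun k _ => ?_
  have : N.submatrix Fin.succ k.succAbove = M.submatrix id k.succAbove := by
    ext; simp [N]
  rw [this]
  simp only [N, Matrix.submatrix_apply, Fin.cons_zero, id]
  ring

/-- If the kernel of a real `p × (p + 1)` matrix is spanned by a vector with nonzero first
coordinate, then its first maximal minor does not vanish. -/
theorem Matrix.minor_zero_ne_zero {p : ℕ} (M : Matrix (Fin p) (Fin (p + 1)) ℝ)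
    (hM : ∀ x, M.mulVec x = 0 → x 0 = 0 → x = 0) :
    (M.submatrix id (Fin.succAbove 0)).det ≠ 0 := by
  intro hdet
  obtain ⟨x, hx, hMx⟩ := Matrix.exists_mulVec_eq_zero_iff.mpr hdet
  refine hx ?_
  have := hM (Fin.cons 0 x) ?_ rfl
  · ext j
    simpa using congrFun this j.succ
  · ext i
    simpa [Matrix.mulVec, dotProduct, Fin.sum_univ_succ] using congrFun hMx i

/-- A family of vectors in `ℝᵖ⁺¹` whose common orthogonal space is a line contains `p` vectors with
the same orthogonal space. -/
theorem exists_fin_orthogonal_of_line {τ : Type*} {p : ℕ} (R : τ → Fin (p + 1) → ℝ)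
    (x : Fin (p + 1) → ℝ) (hx : x ≠ 0) (hRx : ∀ j, R j ⬝ᵥ x = 0)
    (hline : ∀ y, (∀ j, R j ⬝ᵥ y = 0) → ∃ c : ℝ, y = c • x) :
    ∃ r : Fin p → τ, Function.Injective r ∧
      ∀ y, (∀ i, R (r i) ⬝ᵥ y = 0) → ∀ j, R j ⬝ᵥ y = 0 := by
  obtain ⟨f, hf, hspan, hli⟩ :=
    Submodule.exists_fun_fin_finrank_span_eq ℝ (Set.range R)
  choose r hr using hf
  have hker : ∀ y, (∀ i, R (r i) ⬝ᵥ y = 0) → ∀ j, R j ⬝ᵥ y = 0 := by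
    intro y hy j
    have hmem : R j ∈ Submodule.span ℝ (Set.range f) := by
      rw [hspan]
      exact Submodule.subset_span ⟨j, rfl⟩
    generalize R j = z at hmem
    induction hmem using Submodule.span_induction with
    | mem z hz => obtain ⟨i, rfl⟩ := hz; rw [← hr]; exact hy i
    | zero => simp
    | add a b _ _ ha hb => simp [add_dotProduct, ha, hb]
    | smul c a _ ha => simp [smul_dotProduct, ha]
  have hrank : Module.finrank ℝ (Submodule.span ℝ (Set.range R)) = p := by
    have h1 := LinearMap.finrank_range_add_finrank_ker (Matrix.of f).mulVecLin
    have h2 : LinearMap.ker (Matrix.of f).mulVecLin = Submodule.span ℝ {x} := by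
      ext y
      rw [LinearMap.mem_ker, Submodule.mem_span_singleton, Matrix.mulVecLin_apply]
      constructor
      · intro h
        obtain ⟨c, hc⟩ := hline y (hker y fun i => by rw [hr]; exact congrFun h i)
        exact ⟨c, hc.symm⟩
      · rintro ⟨c, rfl⟩
        ext i
        change f i ⬝ᵥ (c • x) = 0
        rw [dotProduct_smul, ← hr, hRx, smul_zero]
    rw [h2, finrank_span_singleton hx] at h1
    have h3 : (Matrix.of f).rank = _ := LinearIndependent.rank_matrix hli
    rw [Matrix.rank] at h3
    simp only [Fintype.card_fin, Module.finrank_fintype_fun_eq_card] at h1 h3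
    omega
  have hinj : Function.Injective r := fun a b hab => hli.injective (by rw [← hr, ← hr, hab])
  let e := finCongr hrank.symm
  refine ⟨r ∘ e, hinj.comp e.injective, fun y hy => hker y fun i => ?_⟩
  simpa using hy (e.symm i)

/-- The constraint map `x ↦ (x, W x)`. -/
noncomputable def idConcat {m n : ℕ} (W : Matrix (Fin m) (Fin n) ℤ) :
    (Fin n → ℝ) →ₗ[ℝ] (Fin n ⊕ Fin m → ℝ) :=
  (Matrix.fromRows 1 (W.map ((↑) : ℤ → ℝ))).mulVecLin

section IdConcat

variable {m n : ℕ} (W : Matrix (Fin m) (Fin n) ℤ)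

@[simp] theorem idConcat_inl (x : Fin n → ℝ) (i : Fin n) : idConcat W x (Sum.inl i) = x i := by
  simp [idConcat, Matrix.fromRows_mulVec]

@[simp] theorem idConcat_inr (x : Fin n → ℝ) (j : Fin m) :
    idConcat W x (Sum.inr j) = ∑ i, (W j i : ℝ) * x i := by
  simp [idConcat, Matrix.mulVec, dotProduct]

theorem idConcat_injective : Function.Injective (idConcat W) := fun x y h => by
  ext i
  simpa using congrFun h (Sum.inl i)

/-- A vector of minimal support with respect to `x ↦ (x, W x)` is proportional to an integer vector
with entries bounded by the subdeterminants of `W`. -/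
theorem exists_int_mem_supportSpace {Δ : ℕ}
    (hW : ∀ (s : ℕ) (r : Fin s → Fin m) (c : Fin s → Fin n),
      Function.Injective r → Function.Injective c → |(W.submatrix r c).det| ≤ (Δ : ℤ))
    (v : Fin n → ℝ) (hv : v ≠ 0)
    (hline : ∀ z ∈ supportSpace (idConcat W) v, ∃ c : ℝ, z = c • v) :
    ∃ z : Fin n → ℤ, z ≠ 0 ∧ (∀ i, |z i| ≤ (Δ : ℤ)) ∧
      (fun i => (z i : ℝ)) ∈ supportSpace (idConcat W) v := by
  classical
  obtain ⟨p, e, he, hrange⟩ : ∃ (p : ℕ) (e : Fin (p + 1) → Fin n), Function.Injective e ∧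
      Set.range e = Function.support v := by
    obtain ⟨i, hi⟩ := Function.ne_iff.mp hv
    let I : Finset (Fin n) := Finset.univ.filter fun i => v i ≠ 0
    have hpos : 0 < I.card := Finset.card_pos.mpr ⟨i, by simpa [I] using hi⟩
    have hcard : I.card = I.card - 1 + 1 := by omega
    exact ⟨I.card - 1, I.orderEmbOfFin hcard, (I.orderEmbOfFin hcard).injective, by
      rw [Finset.range_orderEmbOfFin]; ext; simp [I]⟩
  have hoff : ∀ i, i ∉ Set.range e → v i = 0 := by
    intro i hi
    rw [hrange] at hi
    simpa using hi
  have hve : ∀ k, v (e k) ≠ 0 := fun k => by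
    have : e k ∈ Function.support v := hrange ▸ ⟨k, rfl⟩
    exact this
  let R : {j // ∑ i, (W j i : ℝ) * v i = 0} → Fin (p + 1) → ℝ := fun j k => (W j (e k) : ℝ)
  have hsum : ∀ (y : Fin n → ℝ), (∀ i, i ∉ Set.range e → y i = 0) →
      ∀ j, R j ⬝ᵥ (y ∘ e) = ∑ i, (W j i : ℝ) * y i := by
    intro y hy j
    exact Fintype.sum_of_injective e he _ _ (fun i hi => by simp [hy i hi]) fun k => rfl
  have hmem : ∀ y : Fin n → ℝ, (∀ i, i ∉ Set.range e → y i = 0) →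
      (∀ j, R j ⬝ᵥ (y ∘ e) = 0) → y ∈ supportSpace (idConcat W) v := by
    rintro y hy h (i | j) ha
    · rw [idConcat_inl] at ha ⊢
      exact hy i (by rw [hrange]; simpa using ha)
    · rw [idConcat_inr] at ha ⊢
      rw [← hsum y hy ⟨j, ha⟩]
      exact h _
  have hline' : ∀ y, (∀ j, R j ⬝ᵥ y = 0) → ∃ c : ℝ, y = c • (v ∘ e) := by
    intro y hy
    have hext : Function.extend e y 0 ∘ e = y := Function.extend_comp he y 0
    obtain ⟨c, hc⟩ := hline (Function.extend e y 0)
      (hmem _ (fun i hi => Function.extend_apply' _ _ _ hi) (by rwa [hext]))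
    exact ⟨c, by rw [← hext, hc]; rfl⟩
  obtain ⟨r, hr, hker⟩ := exists_fin_orthogonal_of_line R (v ∘ e)
    (fun h => hve 0 (congrFun h 0)) (fun j => by rw [hsum v hoff]; exact j.2) hline'
  let M : Matrix (Fin p) (Fin (p + 1)) ℤ := W.submatrix (fun i => (r i).1) e
  let z : Fin (p + 1) → ℤ := fun k => (-1) ^ (k : ℕ) * (M.submatrix id k.succAbove).det
  have hz0 : z 0 ≠ 0 := by
    have := Matrix.minor_zero_ne_zero (M.map ((↑) : ℤ → ℝ)) fun x hx hx0 => by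
      obtain ⟨c, rfl⟩ := hline' x (hker x fun i => congrFun hx i)
      have : c = 0 := by simpa [hve] using hx0
      simp [this]
    intro h
    apply this
    have hdet : (M.submatrix id (Fin.succAbove 0)).det = 0 := by simpa [z] using h
    have := congrArg ((↑) : ℤ → ℝ) hdet
    rw [Int.cast_det] at this
    simpa [Matrix.submatrix_map] using this
  have hzext : (fun i => ((Function.extend e z 0 i : ℤ) : ℝ)) ∘ e = fun k => (z k : ℝ) := by
    ext k
    simp [he.extend_apply]
  refine ⟨Function.extend e z 0, fun h => hz0 ?_, fun i => ?_, hmem _ (fun i hi => ?_) ?_⟩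
  · rw [← he.extend_apply z 0 0, h]; rfl
  · by_cases hi : ∃ k, e k = i
    · obtain ⟨k, rfl⟩ := hi
      rw [he.extend_apply]
      simp only [z, abs_mul, abs_pow, abs_neg, abs_one, one_pow, one_mul]
      exact hW p (fun i => (r i).1) (e ∘ k.succAbove) (Subtype.val_injective.comp hr)
        (he.comp Fin.succAbove_right_injective)
    · simp [Function.extend_apply' _ _ _ hi]
  · simp [Function.extend_apply' _ _ _ hi]
  · rw [hzext]
    refine hker _ fun i => ?_
    have := congrArg ((↑) : ℤ → ℝ) (Matrix.sum_mul_minor_eq_zero M i)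
    simp only [Int.cast_sum, Int.cast_mul, Int.cast_zero] at this
    simpa only [dotProduct, R, z, M, Matrix.submatrix_apply, Int.cast_mul, Int.cast_pow,
      Int.cast_neg, Int.cast_one] using this

/-- The integer vectors with entries bounded by `Δ`. -/
def boundedIntVectors (n Δ : ℕ) : Set (Fin n → ℝ) :=
  {v : Fin n → ℝ | ∃ z : Fin n → ℤ, (∀ i, |z i| ≤ (Δ : ℤ)) ∧ v = fun i => (z i : ℝ)}

/-- The integer vectors with entries bounded by the subdeterminants of `W` contain a nonzero vector
conformal to any given nonzero vector with respect to `x ↦ (x, W x)`. -/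
theorem exists_int_conformal {Δ : ℕ}
    (hW : ∀ (s : ℕ) (r : Fin s → Fin m) (c : Fin s → Fin n),
      Function.Injective r → Function.Injective c → |(W.submatrix r c).det| ≤ (Δ : ℤ))
    (y : Fin n → ℝ) (hy : y ≠ 0) :
    ∃ v ∈ boundedIntVectors n Δ, v ≠ 0 ∧ SignConformal (idConcat W v) (idConcat W y) := by
  obtain ⟨v, hv, hvc, hline⟩ := exists_conformal_elementary_s8 _ (idConcat_injective W) y hy
  obtain ⟨z, hz, hzΔ, hmem⟩ := exists_int_mem_supportSpace W hW v hv hline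
  obtain ⟨c, hc⟩ := hline _ hmem
  have hz' : (fun i => (z i : ℝ)) ≠ 0 := fun h => hz (by
    ext i
    simpa using congrFun h i)
  rcases le_total 0 c with h0 | h0
  · refine ⟨_, ⟨z, hzΔ, rfl⟩, hz', SignConformal.trans ?_ hvc⟩
    rw [hc, map_smul]
    exact SignConformal.smul_of_nonneg h0 _
  · refine ⟨-fun i => (z i : ℝ), ⟨-z, by simpa using hzΔ, by ext; simp⟩, neg_ne_zero.mpr hz',
      SignConformal.trans ?_ hvc⟩
    rw [hc, ← neg_smul, map_smul]
    exact SignConformal.smul_of_nonneg (neg_nonneg.mpr h0) _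

/-- The midpoint of two integer points of a polyhedron `W x ≤ w` is also the midpoint of two
integer points whose entrywise distance is at most `2 n Δ`. -/
theorem exists_close_pair_same_midpoint {Δ : ℕ}
    (hW : ∀ (s : ℕ) (r : Fin s → Fin m) (c : Fin s → Fin n),
      Function.Injective r → Function.Injective c → |(W.submatrix r c).det| ≤ (Δ : ℤ))
    (w : Fin m → ℤ) (S : Set (Fin n → ℝ))
    (hS : S = {x | (∀ i, ∃ z : ℤ, x i = (z : ℝ)) ∧
                   ∀ j, (∑ i, (W j i : ℝ) * x i) ≤ (w j : ℝ)})
    (x y : Fin n → ℝ) (hx : x ∈ S) (hy : y ∈ S) :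
    ∃ x' ∈ S, ∃ y' ∈ S, x' + y' = x + y ∧ ∀ i, |y' i - x' i| ≤ 2 * (n * Δ) := by
  obtain ⟨α, v, hα, hv, hconf, hsum⟩ := exists_conformal_decomposition (idConcat W)
    (idConcat_injective W) (boundedIntVectors n Δ) ⟨0, by simp, by ext; simp⟩
    (exists_int_conformal W hW) n (y - x)
    ((Submodule.finrank_le _).trans (by simp))
  choose z hzΔ hvz using hv
  let s : Fin n → ℝ := ∑ j, (⌊α j / 2⌋ : ℝ) • v j
  have hs : ∀ i, ∃ a : ℤ, s i = a := fun i =>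
    ⟨∑ j, ⌊α j / 2⌋ * z j i, by simp [s, Finset.sum_apply, hvz]⟩
  have hfloor : ∀ j, (0 : ℝ) ≤ ⌊α j / 2⌋ := fun j => by
    exact_mod_cast Int.floor_nonneg.mpr (div_nonneg (hα j) zero_le_two)
  have hfloor' : ∀ j, (⌊α j / 2⌋ : ℝ) ≤ α j / 2 := fun j => Int.floor_le _
  have hAs : SignConformal (idConcat W s) (idConcat W (y - x)) := fun a => by
    simp only [s, map_sum, map_smul, Finset.sum_apply, Pi.smul_apply, smul_eq_mul]
    exact ⟨fun h => Finset.sum_nonneg fun j _ => mul_nonneg (hfloor j) ((hconf j a).1 h),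
      fun h => Finset.sum_nonpos fun j _ =>
        mul_nonpos_of_nonneg_of_nonpos (hfloor j) ((hconf j a).2 h)⟩
  have hAs' : SignConformal (idConcat W (y - x - s)) (idConcat W (y - x)) := fun a => by
    have : y - x - s = ∑ j, (α j - ⌊α j / 2⌋) • v j := by
      rw [hsum, ← Finset.sum_sub_distrib]
      simp only [sub_smul]
    have h0 : ∀ j, 0 ≤ α j - ⌊α j / 2⌋ := fun j => by linarith [hα j, hfloor' j]
    rw [this]
    simp only [map_sum, map_smul, Finset.sum_apply, Pi.smul_apply, smul_eq_mul]
    exact ⟨fun h => Finset.sum_nonneg fun j _ => mul_nonneg (h0 j) ((hconf j a).1 h),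
      fun h => Finset.sum_nonpos fun j _ =>
        mul_nonpos_of_nonneg_of_nonpos (h0 j) ((hconf j a).2 h)⟩
  rw [hS] at hx hy
  have hrow : ∀ j, idConcat W (x + s) (Sum.inr j) ≤ w j ∧ idConcat W (y - s) (Sum.inr j) ≤ w j := by
    intro j
    have h1 := hAs (Sum.inr j)
    have h2 := hAs' (Sum.inr j)
    have hxj := hx.2 j
    have hyj := hy.2 j
    rw [← idConcat_inr] at hxj hyj
    simp only [map_sub, map_add, Pi.sub_apply, Pi.add_apply] at h1 h2 ⊢
    rcases le_total 0 (idConcat W y (Sum.inr j) - idConcat W x (Sum.inr j)) with h | h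
    · have := h1.1 h
      have := h2.1 h
      constructor <;> linarith
    · have := h1.2 h
      have := h2.2 h
      constructor <;> linarith
  refine ⟨x + s, ?_, y - s, ?_, by abel, fun i => ?_⟩
  · rw [hS]
    refine ⟨fun i => ?_, fun j => by rw [← idConcat_inr]; exact (hrow j).1⟩
    obtain ⟨a, ha⟩ := hs i
    obtain ⟨b, hb⟩ := hx.1 i
    exact ⟨b + a, by simp [ha, hb]⟩
  · rw [hS]
    refine ⟨fun i => ?_, fun j => by rw [← idConcat_inr]; exact (hrow j).2⟩
    obtain ⟨a, ha⟩ := hs i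
    obtain ⟨b, hb⟩ := hy.1 i
    exact ⟨b - a, by simp [ha, hb]⟩
  · have : (y - s) i - (x + s) i = ∑ j, (α j - 2 * ⌊α j / 2⌋) * v j i := by
      have h1 := congrFun hsum i
      simp only [Pi.sub_apply, Finset.sum_apply, Pi.smul_apply, smul_eq_mul] at h1
      simp only [Pi.sub_apply, Pi.add_apply, s, Finset.sum_apply, Pi.smul_apply, smul_eq_mul,
        sub_mul, Finset.sum_sub_distrib, mul_assoc, ← Finset.mul_sum]
      linarith
    rw [this]
    calc |∑ j, (α j - 2 * ⌊α j / 2⌋) * v j i|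
        ≤ ∑ j, |(α j - 2 * ⌊α j / 2⌋) * v j i| := Finset.abs_sum_le_sum_abs _ _
      _ ≤ ∑ _j : Fin n, 2 * (Δ : ℝ) := by
          refine Finset.sum_le_sum fun j _ => ?_
          rw [abs_mul]
          refine mul_le_mul ?_ ?_ (abs_nonneg _) zero_le_two
          · rw [abs_le]
            constructor <;> linarith [hfloor' j, Int.lt_floor_add_one (α j / 2)]
          · rw [hvz]
            beta_reduce
            exact_mod_cast hzΔ j i
      _ = 2 * (n * Δ) := by simp; ring

end IdConcat


/-- there is an integer point `x^Υ` of the polyhedron whose objective value is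
within `γ k (nΔ)² / g²` of the value at the midpoint `x∘`. -/
theorem stmt_8 (k n m : ℕ) (hk : 0 < k) (hkn : k ≤ n) (hm : 0 < m)
    (Δ : ℕ) (hΔ : 0 < Δ)
    (W : Matrix (Fin m) (Fin n) ℤ)
    (hW : ∀ (s : ℕ) (r : Fin s → Fin m) (c : Fin s → Fin n),
      Function.Injective r → Function.Injective c → |(W.submatrix r c).det| ≤ (Δ : ℤ))
    (w : Fin m → ℤ)
    (S : Set (Fin n → ℝ))
    (hS : S = {x | (∀ i, ∃ z : ℤ, x i = (z : ℝ)) ∧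
                   ∀ j, (∑ i, (W j i : ℝ) * x i) ≤ (w j : ℝ)})
    (q : Fin k → ℝ) (hq : ∀ i, 0 < q i) (h : Fin n → ℝ)
    (f : (Fin n → ℝ) → ℝ)
    (hf : ∀ x, f x = (∑ i : Fin k, -(q i) * (x (Fin.castLE hkn i)) ^ 2) + ∑ i, h i * x i)
    (l u : Fin k → ℝ)
    (hl : ∀ i, (∃ y ∈ S, y (Fin.castLE hkn i) = l i) ∧ ∀ y ∈ S, l i ≤ y (Fin.castLE hkn i))
    (hu : ∀ i, (∃ y ∈ S, y (Fin.castLE hkn i) = u i) ∧ ∀ y ∈ S, y (Fin.castLE hkn i) ≤ u i)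
    (g : ℝ) (hg : 0 < g) (hgap : ∀ i, g ≤ u i - l i)
    (γ : ℝ) (i₀ : Fin k)
    (hγmax : ∀ i, q i * (u i - l i) ^ 2 ≤ γ) (hγatt : γ = q i₀ * (u i₀ - l i₀) ^ 2)
    (xl xu : Fin n → ℝ) (hxl : xl ∈ S) (hxu : xu ∈ S)
    (hxli : xl (Fin.castLE hkn i₀) = l i₀) (hxui : xu (Fin.castLE hkn i₀) = u i₀)
    (x0 : Fin n → ℝ) (hx0 : x0 = fun i => (xl i + xu i) / 2) :
    ∃ xY ∈ S, f x0 - f xY ≤ γ * k * ((n : ℝ) * (Δ : ℝ)) ^ 2 / g ^ 2 := by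
  obtain ⟨x, hx, y, hy, hxy, hdist⟩ := exists_close_pair_same_midpoint W hW w S hS xl xu hxl hxu
  have hmid : ∀ i, x0 i = (x i + y i) / 2 := fun i => by
    rw [hx0, ← Pi.add_apply x y, hxy]; rfl
  have hdiff : f x0 - (f x + f y) / 2 =
      ∑ i : Fin k, q i * ((y (Fin.castLE hkn i) - x (Fin.castLE hkn i)) / 2) ^ 2 := by
    have hlin : ∑ i, h i * x0 i = (∑ i, h i * x i + ∑ i, h i * y i) / 2 := by
      rw [← Finset.sum_add_distrib, Finset.sum_div]
      exact Finset.sum_congr rfl fun i _ => by rw [hmid]; ring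
    have hquad : ∑ i : Fin k, -(q i) * (x0 (Fin.castLE hkn i)) ^ 2 =
        (∑ i : Fin k, -(q i) * (x (Fin.castLE hkn i)) ^ 2 +
          ∑ i : Fin k, -(q i) * (y (Fin.castLE hkn i)) ^ 2) / 2 +
        ∑ i : Fin k, q i * ((y (Fin.castLE hkn i) - x (Fin.castLE hkn i)) / 2) ^ 2 := by
      rw [← Finset.sum_add_distrib, Finset.sum_div, ← Finset.sum_add_distrib]
      exact Finset.sum_congr rfl fun i _ => by rw [hmid]; ring
    rw [hf, hf, hf, hlin, hquad]
    ring
  have hbound : f x0 - (f x + f y) / 2 ≤ γ * k * ((n : ℝ) * (Δ : ℝ)) ^ 2 / g ^ 2 := by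
    rw [hdiff]
    calc _ ≤ ∑ _i : Fin k, γ / g ^ 2 * ((n : ℝ) * (Δ : ℝ)) ^ 2 := by
          refine Finset.sum_le_sum fun i _ => mul_le_mul ?_ ?_ (sq_nonneg _) ?_
          · rw [le_div_iff₀ (by positivity)]
            refine le_trans ?_ (hγmax i)
            have := hq i
            have := hgap i
            gcongr
          · rw [← sq_abs, abs_div, abs_two]
            have := hdist (Fin.castLE hkn i)
            gcongr
            linarith
          · have := hq i₀
            rw [hγatt]
            positivity
      _ = _ := by simp; ring
  rcases le_total (f x) (f y) with hle | hle
  · exact ⟨y, hy, by linarith⟩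
  · exact ⟨x, hx, by linarith⟩
end

section
/- Let k ≤ n and m be positive integers, let Δ be a positive integer, let W ∈ ℤ^{m×n} have all square-submatrix determinants of absolute value at most Δ, and let w ∈ ℤᵐ. Let S = {x ∈ ℤⁿ : Wx ≤ w}, let q₁,…,q_k > 0 and h ∈ ℝⁿ, and define f(x) = Σ_{i=1}^k (−q_i x_i²) + Σ_{i=1}^n h_i x_i. Suppose x* ∈ S satisfies f(x*) ≤ f(x) for all x ∈ S. For each i = 1,…,k suppose l_i = min{x_i : x ∈ S} and u_i = max{x_i : x ∈ S} exist, let g > 0 be a real number with u_i − l_i ≥ g for all i = 1,…,k, and let γ = max{q_i(u_i − l_i)² : i = 1,…,k}. Then there exists x^Υ ∈ S with f(x^Υ) − f(x*) ≥ γ (g² − k(2nΔ)²) / (4g²). -/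
open Matrix in
/-- Adjoining the rows of the identity matrix does not increase the bound on subdeterminants. -/
theorem abs_det_submatrix_fromRows_one_le {m n Δ : ℕ} (hΔ : 0 < Δ)
    (W : Matrix (Fin m) (Fin n) ℤ)
    (hW : ∀ (s : ℕ) (r : Fin s → Fin m) (c : Fin s → Fin n),
      Function.Injective r → Function.Injective c → |(W.submatrix r c).det| ≤ (Δ : ℤ))
    (s : ℕ) (r : Fin s → Fin m ⊕ Fin n) (c : Fin s → Fin n) (hc : Function.Injective c) :
    |((fromRows W (1 : Matrix (Fin n) (Fin n) ℤ)).submatrix r c).det| ≤ (Δ : ℤ) := by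
  induction s with
  | zero => simpa using Nat.succ_le_of_lt hΔ
  | succ s ih =>
    by_cases hr : ∃ i j, r i = Sum.inr j
    · obtain ⟨i, j, hij⟩ := hr
      rw [det_succ_row _ i]
      by_cases hj : ∃ p, c p = j
      · obtain ⟨p, rfl⟩ := hj
        rw [Finset.sum_eq_single p]
        · have := ih (r ∘ i.succAbove) (c ∘ p.succAbove)
            (hc.comp Fin.succAbove_right_injective)
          simpa [submatrix_apply, hij, abs_mul, abs_pow, submatrix_submatrix] using this
        · intro b _ hb
          have : c p ≠ c b := fun h => hb (hc h).symm
          simp [hij, one_apply, this]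
        · simp
      · rw [Finset.sum_eq_zero]
        · simp
        · intro b _
          have : j ≠ c b := fun h => hj ⟨b, h.symm⟩
          simp [hij, one_apply, this]
    · have hl : ∀ i, ∃ j, r i = Sum.inl j := by
        intro i
        rcases h : r i with j | j
        · exact ⟨j, rfl⟩
        · exact absurd ⟨i, j, h⟩ hr
      choose r' hr' using hl
      have heq : (fromRows W (1 : Matrix (Fin n) (Fin n) ℤ)).submatrix r c = W.submatrix r' c := by
        ext a b
        simp [hr']
      rw [heq]
      by_cases hinj : Function.Injective r'
      · exact hW _ r' c hinj hc
      · simp only [Function.Injective, not_forall] at hinj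
        obtain ⟨a, b, hab, hne⟩ := hinj
        rw [det_zero_of_row_eq hne (by ext; simp [hab])]
        simp

open Matrix in
/-- The vectors annihilated by every row of `A` that annihilates `x`. -/
def tightSpace {ι : Type*} {n : ℕ} (A : Matrix ι (Fin n) ℝ) (x : Fin n → ℝ) :
    Submodule ℝ (Fin n → ℝ) where
  carrier := {v | ∀ j, (A *ᵥ x) j = 0 → (A *ᵥ v) j = 0}
  add_mem' := by
    intro a b ha hb j hj
    simp [mulVec_add, ha j hj, hb j hj]
  zero_mem' := by
    intro j _
    simp
  smul_mem' := by
    intro c a ha j hj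
    simp [mulVec_smul, ha j hj]

open Matrix in
theorem mem_tightSpace {ι : Type*} {n : ℕ} {A : Matrix ι (Fin n) ℝ} {x v : Fin n → ℝ} :
    v ∈ tightSpace A x ↔ ∀ j, (A *ᵥ x) j = 0 → (A *ᵥ v) j = 0 := Iff.rfl

theorem self_mem_tightSpace {ι : Type*} {n : ℕ} (A : Matrix ι (Fin n) ℝ) (x : Fin n → ℝ) :
    x ∈ tightSpace A x := fun _ hj => hj

open Matrix in
/-- Moving inside a polyhedral cone along `-z` until a new constraint becomes tight. -/
theorem exists_sub_smul_tightSpace_lt {ι : Type*} [Fintype ι] {n : ℕ} (A : Matrix ι (Fin n) ℝ)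
    (s : ι → ℝ) (x z : Fin n → ℝ) (hx : ∀ j, 0 ≤ s j * (A *ᵥ x) j)
    (hz : z ∈ tightSpace A x) (hpos : ∃ j, 0 < s j * (A *ᵥ z) j) :
    ∃ α : ℝ, 0 ≤ α ∧ (∀ j, 0 ≤ s j * (A *ᵥ (x - α • z)) j) ∧
      tightSpace A (x - α • z) < tightSpace A x := by
  classical
  obtain ⟨j₀, hj₀⟩ := hpos
  obtain ⟨p, hp, hmin⟩ := Finset.exists_min_image
    (Finset.univ.filter fun j => 0 < s j * (A *ᵥ z) j)
    (fun j => (s j * (A *ᵥ x) j) / (s j * (A *ᵥ z) j)) ⟨j₀, by simpa using hj₀⟩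
  simp only [Finset.mem_filter, Finset.mem_univ, true_and] at hp hmin
  set α := (s p * (A *ᵥ x) p) / (s p * (A *ᵥ z) p) with hα
  have hα0 : 0 ≤ α := div_nonneg (hx p) hp.le
  have hexp : ∀ j, (A *ᵥ (x - α • z)) j = (A *ᵥ x) j - α * (A *ᵥ z) j := by
    intro j
    simp [mulVec_sub, mulVec_smul]
  refine ⟨α, hα0, ?_, ?_⟩
  · intro j
    rw [hexp]
    by_cases hj : 0 < s j * (A *ᵥ z) j
    · have := (le_div_iff₀ hj).1 (hmin j hj)
      linarith
    · have := mul_nonneg hα0 (neg_nonneg.2 (not_lt.1 hj))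
      linarith [hx j]
  · refine lt_of_le_of_ne ?_ ?_
    · intro v hv j hj
      refine hv j ?_
      rw [hexp, hj, hz j hj]
      simp
    · intro heq
      have hz' : z ∈ tightSpace A (x - α • z) := heq ▸ hz
      have hsp : s p ≠ 0 := fun h => by simp [h] at hp
      have hzp : (A *ᵥ z) p ≠ 0 := fun h => by simp [h] at hp
      refine hzp (hz' p ?_)
      rw [hexp, hα]
      field_simp
      simp

open Matrix in
/-- A one-dimensional tight space contains a nonzero integer vector with entries bounded by the
subdeterminants. -/
theorem exists_int_mem_tightSpace {m n : ℕ} {Δ : ℕ} (W : Matrix (Fin m) (Fin n) ℤ)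
    (hdet : ∀ r : Fin n → Fin m ⊕ Fin n,
      |((fromRows W (1 : Matrix (Fin n) (Fin n) ℤ)).submatrix r id).det| ≤ (Δ : ℤ))
    (A : Matrix (Fin m ⊕ Fin n) (Fin n) ℝ)
    (hA : A = (fromRows W (1 : Matrix (Fin n) (Fin n) ℤ)).map (Int.cast : ℤ → ℝ))
    (x : Fin n → ℝ) (hx : x ≠ 0) (hspan : ∀ z ∈ tightSpace A x, ∃ c : ℝ, z = c • x) :
    ∃ v : Fin n → ℤ, (∀ i, |v i| ≤ Δ) ∧ ∃ c : ℝ, c ≠ 0 ∧ (fun i => (v i : ℝ)) = c • x := by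
  classical
  obtain ⟨i₀, hi₀⟩ := Function.ne_iff.1 hx
  simp only [Pi.zero_apply] at hi₀
  have hAr : ∀ (i : Fin n) (y : Fin n → ℝ), (A *ᵥ y) (Sum.inr i) = y i := by
    intro i y
    simp [hA, mulVec, dotProduct, one_apply]
  let J := {j : Fin m ⊕ Fin n // (A *ᵥ x) j = 0 ∨ j = Sum.inr i₀}
  obtain ⟨κ, a, ha, hsp, hli⟩ := exists_linearIndependent' ℝ (fun j : J => A j.1)
  have hker : ∀ y : Fin n → ℝ, (∀ p, (A *ᵥ y) (a p).1 = 0) → y = 0 := by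
    intro y hy
    have hall : ∀ j : J, (A *ᵥ y) j.1 = 0 := by
      let φ : (Fin n → ℝ) →ₗ[ℝ] ℝ := dotProductBilin ℝ ℝ |>.flip y
      have hle : Submodule.span ℝ (Set.range ((fun j : J => A j.1) ∘ a)) ≤ LinearMap.ker φ := by
        rw [Submodule.span_le]
        rintro _ ⟨p, rfl⟩
        exact hy p
      intro j
      have : A j.1 ∈ LinearMap.ker φ :=
        hle (hsp ▸ Submodule.subset_span ⟨j, rfl⟩)
      exact this
    obtain ⟨c, rfl⟩ := hspan y (fun j hj => hall ⟨j, Or.inl hj⟩)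
    have h0 := hall ⟨Sum.inr i₀, Or.inr rfl⟩
    rw [hAr] at h0
    have : c = 0 := by simpa [hi₀] using h0
    simp [this]
  have : Finite κ := hli.finite
  let _ : Fintype κ := Fintype.ofFinite κ
  have hcard : Fintype.card κ = n := by
    apply le_antisymm
    · simpa using hli.fintype_card_le_finrank
    · let T : (Fin n → ℝ) →ₗ[ℝ] (κ → ℝ) := (A.submatrix (fun p => (a p).1) id).mulVecLin
      have hT : Function.Injective T := by
        rw [← LinearMap.ker_eq_bot, LinearMap.ker_eq_bot']
        intro y hy
        exact hker y fun p => congrFun hy p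
      simpa using LinearMap.finrank_le_finrank_of_injective hT
  let e : Fin n ≃ κ := (Fintype.equivFinOfCardEq hcard).symm
  let r : Fin n → Fin m ⊕ Fin n := fun i => (a (e i)).1
  have hrinj : Function.Injective r :=
    Subtype.val_injective.comp (ha.comp e.injective)
  let M : Matrix (Fin n) (Fin n) ℤ :=
    (fromRows W (1 : Matrix (Fin n) (Fin n) ℤ)).submatrix r id
  let MR : Matrix (Fin n) (Fin n) ℝ := M.map (Int.cast : ℤ → ℝ)
  have hMR : ∀ y i, (MR *ᵥ y) i = (A *ᵥ y) (r i) := by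
    intro y i
    rw [hA]
    rfl
  have hMker : ∀ y, MR *ᵥ y = 0 → y = 0 := by
    intro y hy
    refine hker y fun p => ?_
    have := congrFun hy (e.symm p)
    rw [hMR] at this
    simpa [r] using this
  obtain ⟨j₀, hj₀⟩ : ∃ j₀, r j₀ = Sum.inr i₀ := by
    by_contra hne
    push Not at hne
    refine hx (hMker x ?_)
    ext i
    rw [hMR]
    exact (a (e i)).2.resolve_right (hne i)
  have hMx : MR *ᵥ x = Pi.single j₀ (x i₀) := by
    ext i
    rw [hMR]
    by_cases hi : i = j₀
    · subst hi
      rw [hj₀, hAr]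
      simp
    · rw [Pi.single_eq_of_ne hi]
      refine (a (e i)).2.resolve_right fun h => hi (hrinj ?_)
      exact h.trans hj₀.symm
  have hMdet : MR.det ≠ 0 := by
    intro h0
    obtain ⟨y, hy, hy0⟩ := exists_mulVec_eq_zero_iff.2 h0
    exact hy (hMker y hy0)
  refine ⟨fun i => M.adjugate i j₀, ?_, MR.det / x i₀, div_ne_zero hMdet hi₀, ?_⟩
  · intro i
    simp only [adjugate_apply]
    have : M.updateRow j₀ (Pi.single i 1) =
        (fromRows W (1 : Matrix (Fin n) (Fin n) ℤ)).submatrix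
          (Function.update r j₀ (Sum.inr i)) id := by
      ext p t
      by_cases hp : p = j₀
      · subst hp
        simp [one_apply, Pi.single_apply, eq_comm]
      · simp [hp, M]
    rw [this]
    exact hdet _
  · have hadj : MR.adjugate = M.adjugate.map (Int.cast : ℤ → ℝ) :=
      ((Int.castRingHom ℝ).map_adjugate M).symm
    have hv : (fun i => ((M.adjugate i j₀ : ℤ) : ℝ)) = MR.adjugate *ᵥ Pi.single j₀ 1 := by
      ext i
      simp [hadj]
    rw [hv]
    have h1 : MR.adjugate *ᵥ (MR *ᵥ x) = MR.det • x := by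
      rw [mulVec_mulVec, adjugate_mul, smul_mulVec, one_mulVec]
    have h2 : (Pi.single j₀ (x i₀) : Fin n → ℝ) = x i₀ • Pi.single j₀ 1 := by
      rw [← Pi.single_smul]
      simp
    rw [hMx, h2, mulVec_smul] at h1
    rw [div_eq_inv_mul, mul_smul, ← h1, smul_smul, inv_mul_cancel₀ hi₀, one_smul]

open Matrix in
/-- Every nonzero element of the cone admits, in its minimal face, an integer cone vector with
entries bounded by the subdeterminants. -/
theorem exists_int_cone_mem_tightSpace {m n : ℕ} {Δ : ℕ} (W : Matrix (Fin m) (Fin n) ℤ)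
    (hdet : ∀ r : Fin n → Fin m ⊕ Fin n,
      |((fromRows W (1 : Matrix (Fin n) (Fin n) ℤ)).submatrix r id).det| ≤ (Δ : ℤ))
    (A : Matrix (Fin m ⊕ Fin n) (Fin n) ℝ)
    (hA : A = (fromRows W (1 : Matrix (Fin n) (Fin n) ℤ)).map (Int.cast : ℤ → ℝ))
    (s : Fin m ⊕ Fin n → ℝ) (hs : ∀ j, s j ≠ 0) (x : Fin n → ℝ) (hx0 : x ≠ 0)
    (hx : ∀ j, 0 ≤ s j * (A *ᵥ x) j) :
    ∃ v : Fin n → ℤ, v ≠ 0 ∧ (∀ i, |v i| ≤ Δ) ∧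
      (∀ j, 0 ≤ s j * (A *ᵥ (fun i => (v i : ℝ))) j) ∧
      (fun i => (v i : ℝ)) ∈ tightSpace A x := by
  induction hN : Module.finrank ℝ (tightSpace A x) using Nat.strong_induction_on
    generalizing x with
  | _ N ih =>
  by_cases hspan : ∀ z ∈ tightSpace A x, ∃ c : ℝ, z = c • x
  · obtain ⟨v, hv, c, hc, hvc⟩ := exists_int_mem_tightSpace W hdet A hA x hx0 hspan
    have hv0 : v ≠ 0 := by
      rintro rfl
      refine smul_ne_zero hc hx0 ?_
      rw [← hvc]
      ext
      simp
    have hmem : (fun i => (v i : ℝ)) ∈ tightSpace A x :=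
      hvc ▸ Submodule.smul_mem _ c (self_mem_tightSpace A x)
    rcases lt_or_gt_of_ne hc with hneg | hpos
    · have hcast : (fun i => (((-v) i : ℤ) : ℝ)) = -(fun i => (v i : ℝ)) := by
        ext
        simp
      refine ⟨-v, neg_ne_zero.2 hv0, by simpa using hv, ?_, ?_⟩
      · intro j
        rw [hcast, hvc, ← neg_smul, mulVec_smul, Pi.smul_apply, smul_eq_mul, mul_left_comm]
        exact mul_nonneg (by linarith) (hx j)
      · rw [hcast]
        exact Submodule.neg_mem _ hmem
    · refine ⟨v, hv0, hv, ?_, hmem⟩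
      intro j
      rw [hvc, mulVec_smul, Pi.smul_apply, smul_eq_mul, mul_left_comm]
      exact mul_nonneg hpos.le (hx j)
  · push Not at hspan
    obtain ⟨z, hz, hzx⟩ := hspan
    obtain ⟨z', hz', hzx', hpos⟩ : ∃ z' ∈ tightSpace A x, (∀ c : ℝ, z' ≠ c • x) ∧
        ∃ j, 0 < s j * (A *ᵥ z') j := by
      have hz0 : z ≠ 0 := fun h => hzx 0 (by simp [h])
      obtain ⟨i, hi⟩ := Function.ne_iff.1 hz0
      have hAi : (A *ᵥ z) (Sum.inr i) = z i := by
        simp [hA, mulVec, dotProduct, one_apply]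
      have hne : s (Sum.inr i) * (A *ᵥ z) (Sum.inr i) ≠ 0 := by
        rw [hAi]
        exact mul_ne_zero (hs _) hi
      rcases lt_or_gt_of_ne hne with hlt | hgt
      · refine ⟨-z, Submodule.neg_mem _ hz, fun c hc => hzx (-c) ?_, Sum.inr i, ?_⟩
        · rw [neg_smul, ← hc, neg_neg]
        · rw [mulVec_neg, Pi.neg_apply]
          linarith
      · exact ⟨z, hz, hzx, Sum.inr i, hgt⟩
    obtain ⟨α, -, hcone, hlt⟩ := exists_sub_smul_tightSpace_lt A s x z' hx hz' hpos
    have hne : x - α • z' ≠ 0 := by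
      intro h0
      have hxα := sub_eq_zero.1 h0
      have hα : α ≠ 0 := by
        rintro rfl
        exact hx0 (by simpa using hxα)
      exact hzx' α⁻¹ (by rw [hxα, smul_smul, inv_mul_cancel₀ hα, one_smul])
    obtain ⟨v, hv0, hv, hvc, hvm⟩ :=
      ih _ (hN ▸ Submodule.finrank_lt_finrank_of_lt hlt) _ hne hcone rfl
    exact ⟨v, hv0, hv, hvc, hlt.le hvm⟩

open Matrix in
/-- Rounding a point of the cone to an integer point, conformally. -/
theorem exists_int_conformal_rounding {m n : ℕ} {Δ : ℕ} (W : Matrix (Fin m) (Fin n) ℤ)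
    (hdet : ∀ r : Fin n → Fin m ⊕ Fin n,
      |((fromRows W (1 : Matrix (Fin n) (Fin n) ℤ)).submatrix r id).det| ≤ (Δ : ℤ))
    (A : Matrix (Fin m ⊕ Fin n) (Fin n) ℝ)
    (hA : A = (fromRows W (1 : Matrix (Fin n) (Fin n) ℤ)).map (Int.cast : ℤ → ℝ))
    (s : Fin m ⊕ Fin n → ℝ) (hs : ∀ j, s j ≠ 0) (x : Fin n → ℝ)
    (hx : ∀ j, 0 ≤ s j * (A *ᵥ x) j) :
    ∃ y : Fin n → ℤ, (∀ j, 0 ≤ s j * (A *ᵥ (fun i => (y i : ℝ))) j) ∧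
      (∀ j, 0 ≤ s j * (A *ᵥ (x - fun i => (y i : ℝ))) j) ∧
      ∀ i, |x i - y i| ≤ Module.finrank ℝ (tightSpace A x) * (Δ : ℝ) := by
  induction hN : Module.finrank ℝ (tightSpace A x) using Nat.strong_induction_on
    generalizing x with
  | _ N ih =>
  by_cases hx0 : x = 0
  · subst hx0
    have hcast : (fun i => (((0 : Fin n → ℤ) i : ℤ) : ℝ)) = 0 := by
      ext
      simp
    refine ⟨0, ?_, ?_, ?_⟩
    · rwa [hcast]
    · rwa [hcast, sub_zero]
    · intro i
      simp only [Pi.zero_apply, Int.cast_zero, sub_zero, abs_zero]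
      positivity
  obtain ⟨v, hv0, hv, hvc, hvm⟩ := exists_int_cone_mem_tightSpace W hdet A hA s hs x hx0 hx
  have hpos : ∃ j, 0 < s j * (A *ᵥ (fun i => (v i : ℝ))) j := by
    obtain ⟨i, hi⟩ := Function.ne_iff.1 hv0
    refine ⟨Sum.inr i, lt_of_le_of_ne (hvc _) (Ne.symm ?_)⟩
    have hAi : (A *ᵥ (fun i => (v i : ℝ))) (Sum.inr i) = v i := by
      simp [hA, mulVec, dotProduct, one_apply]
    rw [hAi]
    exact mul_ne_zero (hs _) (by exact_mod_cast hi)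
  obtain ⟨α, hα, hcone, hlt⟩ := exists_sub_smul_tightSpace_lt A s x _ hx hvm hpos
  have hrank := Submodule.finrank_lt_finrank_of_lt hlt
  rw [hN] at hrank
  obtain ⟨y, hy, hxy, hb⟩ := ih _ hrank _ hcone rfl
  have hfl : (0 : ℝ) ≤ (⌊α⌋ : ℝ) := by exact_mod_cast Int.floor_nonneg.2 hα
  have hcast : (fun i => (((y + ⌊α⌋ • v) i : ℤ) : ℝ)) =
      (fun i => (y i : ℝ)) + (⌊α⌋ : ℝ) • fun i => (v i : ℝ) := by
    ext
    simp
  refine ⟨y + ⌊α⌋ • v, ?_, ?_, ?_⟩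
  · intro j
    rw [hcast, mulVec_add, mulVec_smul, Pi.add_apply, Pi.smul_apply, smul_eq_mul, mul_add,
      mul_left_comm]
    exact add_nonneg (hy j) (mul_nonneg hfl (hvc j))
  · intro j
    have hsplit : x - (fun i => (((y + ⌊α⌋ • v) i : ℤ) : ℝ)) =
        (x - α • (fun i => (v i : ℝ)) - fun i => (y i : ℝ)) +
          Int.fract α • fun i => (v i : ℝ) := by
      rw [hcast, ← Int.self_sub_floor, sub_smul]
      abel
    rw [hsplit, mulVec_add, mulVec_smul, Pi.add_apply, Pi.smul_apply, smul_eq_mul, mul_add,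
      mul_left_comm]
    exact add_nonneg (hxy j) (mul_nonneg (Int.fract_nonneg α) (hvc j))
  · intro i
    have hvi : |(v i : ℝ)| ≤ Δ := by exact_mod_cast hv i
    have hsplit : x i - (((y + ⌊α⌋ • v) i : ℤ) : ℝ) =
        ((x - α • (fun i => (v i : ℝ))) i - y i) + Int.fract α * v i := by
      simp only [Pi.add_apply, Pi.sub_apply, Pi.smul_apply, smul_eq_mul, Int.cast_add,
        Int.cast_mul]
      linear_combination -(v i : ℝ) * Int.floor_add_fract α
    have hfr : |Int.fract α * (v i : ℝ)| ≤ Δ := by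
      rw [abs_mul, abs_of_nonneg (Int.fract_nonneg α)]
      calc Int.fract α * |(v i : ℝ)| ≤ 1 * |(v i : ℝ)| :=
            mul_le_mul_of_nonneg_right (Int.fract_lt_one α).le (abs_nonneg _)
        _ ≤ Δ := by rwa [one_mul]
    rw [hsplit]
    have hN' : (Module.finrank ℝ (tightSpace A (x - α • fun i => (v i : ℝ))) : ℝ) + 1 ≤ N := by
      exact_mod_cast hrank
    calc _ ≤ _ := abs_add_le _ _
      _ ≤ _ := add_le_add (hb i) hfr
      _ = (Module.finrank ℝ (tightSpace A (x - α • fun i => (v i : ℝ))) + 1 : ℝ) * Δ := by ring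
      _ ≤ _ := mul_le_mul_of_nonneg_right hN' (Nat.cast_nonneg _)

open Matrix in
/-- An integer vector `d` splits conformally into two integer vectors that differ by at most
`2 * n * Δ` in every coordinate. -/
theorem exists_int_near_half {m n Δ : ℕ} (hΔ : 0 < Δ) (W : Matrix (Fin m) (Fin n) ℤ)
    (hW : ∀ (s : ℕ) (r : Fin s → Fin m) (c : Fin s → Fin n),
      Function.Injective r → Function.Injective c → |(W.submatrix r c).det| ≤ (Δ : ℤ))
    (d : Fin n → ℝ) :
    ∃ y : Fin n → ℤ,
      (∀ j, min 0 (∑ i, (W j i : ℝ) * d i) ≤ ∑ i, (W j i : ℝ) * y i ∧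
        ∑ i, (W j i : ℝ) * y i ≤ max 0 (∑ i, (W j i : ℝ) * d i)) ∧
      ∀ i, |d i - 2 * y i| ≤ 2 * (n : ℝ) * Δ := by
  set A : Matrix (Fin m ⊕ Fin n) (Fin n) ℝ :=
    (fromRows W (1 : Matrix (Fin n) (Fin n) ℤ)).map (Int.cast : ℤ → ℝ) with hA
  have hAl : ∀ j y, (A *ᵥ y) (Sum.inl j) = ∑ i, (W j i : ℝ) * y i := fun j y => by
    simp [hA, mulVec, dotProduct]
  let s : Fin m ⊕ Fin n → ℝ := fun j => if 0 ≤ (A *ᵥ d) j then 1 else -1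
  have hs : ∀ j, s j ≠ 0 := by
    intro j
    simp only [s]
    split_ifs <;> norm_num
  have hx : ∀ j, 0 ≤ s j * (A *ᵥ ((1 / 2 : ℝ) • d)) j := by
    intro j
    rw [mulVec_smul, Pi.smul_apply, smul_eq_mul]
    simp only [s]
    split_ifs with h0 <;> linarith
  obtain ⟨y, hy, hxy, hb⟩ := exists_int_conformal_rounding W
    (fun r => abs_det_submatrix_fromRows_one_le hΔ W hW n r id Function.injective_id)
    A hA s hs _ hx
  refine ⟨y, fun j => ?_, fun i => ?_⟩
  · have h1 := hy (Sum.inl j)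
    have h2 := hxy (Sum.inl j)
    rw [mulVec_sub, mulVec_smul, Pi.sub_apply, Pi.smul_apply, smul_eq_mul] at h2
    simp only [s, hAl] at h1 h2
    split_ifs at h1 h2 with h0
    · rw [min_eq_left h0, max_eq_right h0]
      constructor <;> linarith
    · rw [min_eq_right (by linarith), max_eq_left (by linarith)]
      constructor <;> linarith
  · have hrank : (Module.finrank ℝ (tightSpace A ((1 / 2 : ℝ) • d)) : ℝ) ≤ n := by
      have := Submodule.finrank_le (tightSpace A ((1 / 2 : ℝ) • d))
      rw [Module.finrank_fin_fun] at this
      exact_mod_cast this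
    have h1 : |d i - 2 * y i| = 2 * |((1 / 2 : ℝ) • d) i - y i| := by
      rw [← abs_two, ← abs_mul, abs_two]
      congr 1
      simp
      ring
    have h2 := mul_le_mul_of_nonneg_right hrank (Nat.cast_nonneg (α := ℝ) Δ)
    rw [h1]
    linarith [hb i]

/-- lower bound on the gap between the maximum and minimum of the separable
concave quadratic `f` over the integer points of the polyhedron. -/
theorem stmt_9 (k n m : ℕ) (hk : 0 < k) (hkn : k ≤ n) (hm : 0 < m)
    (Δ : ℕ) (hΔ : 0 < Δ)
    (W : Matrix (Fin m) (Fin n) ℤ)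
    (hW : ∀ (s : ℕ) (r : Fin s → Fin m) (c : Fin s → Fin n),
      Function.Injective r → Function.Injective c → |(W.submatrix r c).det| ≤ (Δ : ℤ))
    (w : Fin m → ℤ)
    (S : Set (Fin n → ℝ))
    (hS : S = {x | (∀ i, ∃ z : ℤ, x i = (z : ℝ)) ∧
                   ∀ j, (∑ i, (W j i : ℝ) * x i) ≤ (w j : ℝ)})
    (q : Fin k → ℝ) (hq : ∀ i, 0 < q i) (h : Fin n → ℝ)
    (f : (Fin n → ℝ) → ℝ)
    (hf : ∀ x, f x = (∑ i : Fin k, -(q i) * (x (Fin.castLE hkn i)) ^ 2) + ∑ i, h i * x i)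
    (xstar : Fin n → ℝ) (hxstarS : xstar ∈ S) (hxstar : ∀ x ∈ S, f xstar ≤ f x)
    (l u : Fin k → ℝ)
    (hl : ∀ i, (∃ y ∈ S, y (Fin.castLE hkn i) = l i) ∧ ∀ y ∈ S, l i ≤ y (Fin.castLE hkn i))
    (hu : ∀ i, (∃ y ∈ S, y (Fin.castLE hkn i) = u i) ∧ ∀ y ∈ S, y (Fin.castLE hkn i) ≤ u i)
    (g : ℝ) (hg : 0 < g) (hgap : ∀ i, g ≤ u i - l i)
    (γ : ℝ)
    (hγmax : ∀ i, q i * (u i - l i) ^ 2 ≤ γ) (hγatt : ∃ i, γ = q i * (u i - l i) ^ 2) :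
    ∃ xY ∈ S, f xY - f xstar ≥
      γ * (g ^ 2 - k * (2 * (n : ℝ) * (Δ : ℝ)) ^ 2) / (4 * g ^ 2) := by
  obtain ⟨t, ht⟩ := hγatt
  obtain ⟨⟨xl, hxlS, hxl⟩, -⟩ := hl t
  obtain ⟨⟨xu, hxuS, hxu⟩, -⟩ := hu t
  obtain ⟨y, hyW, hyb⟩ := exists_int_near_half hΔ W hW (xu - xl)
  set a : Fin n → ℝ := fun i => xl i + y i with ha
  set b : Fin n → ℝ := fun i => xu i - y i with hb
  have hfl := hxstar xl hxlS
  have hfu := hxstar xu hxuS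
  rw [hS] at hxlS hxuS
  have hdW : ∀ j, ∑ i, (W j i : ℝ) * (xu - xl) i =
      ∑ i, (W j i : ℝ) * xu i - ∑ i, (W j i : ℝ) * xl i := by
    intro j
    simp [mul_sub, Finset.sum_sub_distrib]
  have haS : a ∈ S := by
    rw [hS]
    refine ⟨fun i => ?_, fun j => ?_⟩
    · obtain ⟨z, hz⟩ := hxlS.1 i
      exact ⟨z + y i, by simp [ha, hz]⟩
    · have h1 := (hyW j).2
      rw [hdW] at h1
      have h2 : ∑ i, (W j i : ℝ) * a i =
          ∑ i, (W j i : ℝ) * xl i + ∑ i, (W j i : ℝ) * y i := by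
        simp [ha, mul_add, Finset.sum_add_distrib]
      rw [h2]
      rcases le_max_iff.1 h1 with h3 | h3 <;> linarith [hxlS.2 j, hxuS.2 j]
  have hbS : b ∈ S := by
    rw [hS]
    refine ⟨fun i => ?_, fun j => ?_⟩
    · obtain ⟨z, hz⟩ := hxuS.1 i
      exact ⟨z - y i, by simp [hb, hz]⟩
    · have h1 := (hyW j).1
      rw [hdW] at h1
      have h2 : ∑ i, (W j i : ℝ) * b i =
          ∑ i, (W j i : ℝ) * xu i - ∑ i, (W j i : ℝ) * y i := by
        simp [hb, mul_sub, Finset.sum_sub_distrib]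
      rw [h2]
      rcases min_le_iff.1 h1 with h3 | h3 <;> linarith [hxlS.2 j, hxuS.2 j]
  set B : ℝ := 2 * (n : ℝ) * (Δ : ℝ) with hB
  have hg2 : 0 < g ^ 2 := by positivity
  have hident : f a + f b - f xl - f xu = ∑ i : Fin k, (q i / 2 *
      (xu (Fin.castLE hkn i) - xl (Fin.castLE hkn i)) ^ 2 -
      q i / 2 * (xu (Fin.castLE hkn i) - xl (Fin.castLE hkn i) - 2 * y (Fin.castLE hkn i)) ^ 2) := by
    have hlin : ∑ i, h i * a i + ∑ i, h i * b i = ∑ i, h i * xl i + ∑ i, h i * xu i := by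
      rw [← Finset.sum_add_distrib, ← Finset.sum_add_distrib]
      refine Finset.sum_congr rfl fun i _ => ?_
      simp only [ha, hb]
      ring
    have hquad : ∑ i : Fin k, -(q i) * (a (Fin.castLE hkn i)) ^ 2 +
        ∑ i : Fin k, -(q i) * (b (Fin.castLE hkn i)) ^ 2 -
        ∑ i : Fin k, -(q i) * (xl (Fin.castLE hkn i)) ^ 2 -
        ∑ i : Fin k, -(q i) * (xu (Fin.castLE hkn i)) ^ 2 = ∑ i : Fin k, (q i / 2 *
      (xu (Fin.castLE hkn i) - xl (Fin.castLE hkn i)) ^ 2 -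
      q i / 2 * (xu (Fin.castLE hkn i) - xl (Fin.castLE hkn i) - 2 * y (Fin.castLE hkn i)) ^ 2) := by
      rw [← Finset.sum_add_distrib, ← Finset.sum_sub_distrib, ← Finset.sum_sub_distrib]
      refine Finset.sum_congr rfl fun i _ => ?_
      simp only [ha, hb]
      ring
    rw [← hquad, hf, hf, hf, hf]
    linarith
  have hfirst : γ / 2 ≤ ∑ i : Fin k, q i / 2 *
      (xu (Fin.castLE hkn i) - xl (Fin.castLE hkn i)) ^ 2 := by
    have := Finset.single_le_sum (f := fun i : Fin k => q i / 2 *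
      (xu (Fin.castLE hkn i) - xl (Fin.castLE hkn i)) ^ 2)
      (fun i _ => mul_nonneg (by linarith [hq i]) (sq_nonneg _)) (Finset.mem_univ t)
    simp only [hxu, hxl] at this
    rw [ht]
    linarith
  have hsecond : ∑ i : Fin k, q i / 2 *
      (xu (Fin.castLE hkn i) - xl (Fin.castLE hkn i) - 2 * y (Fin.castLE hkn i)) ^ 2 ≤
      k * (γ / g ^ 2 / 2 * B ^ 2) := by
    have hterm : ∀ i ∈ (Finset.univ : Finset (Fin k)), q i / 2 *
        (xu (Fin.castLE hkn i) - xl (Fin.castLE hkn i) - 2 * y (Fin.castLE hkn i)) ^ 2 ≤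
        γ / g ^ 2 / 2 * B ^ 2 := by
      intro i _
      have hsq : (xu (Fin.castLE hkn i) - xl (Fin.castLE hkn i) -
          2 * y (Fin.castLE hkn i)) ^ 2 ≤ B ^ 2 := by
        rw [← sq_abs]
        exact pow_le_pow_left₀ (abs_nonneg _) (hyb (Fin.castLE hkn i)) 2
      have hqi : q i ≤ γ / g ^ 2 := by
        rw [le_div_iff₀ hg2]
        refine le_trans ?_ (hγmax i)
        exact mul_le_mul_of_nonneg_left (pow_le_pow_left₀ hg.le (hgap i) 2) (hq i).le
      exact mul_le_mul (by linarith) hsq (sq_nonneg _) (by linarith [hq i])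
    simpa using Finset.sum_le_sum hterm
  rw [Finset.sum_sub_distrib] at hident
  have hrhs : γ * (g ^ 2 - k * B ^ 2) / (4 * g ^ 2) =
      (γ / 2 - k * (γ / g ^ 2 / 2 * B ^ 2)) / 2 := by
    field_simp
    ring
  rw [hrhs]
  rcases le_total (f a) (f b) with hab | hab
  · exact ⟨b, hbS, by linarith⟩
  · exact ⟨a, haS, by linarith⟩
end

section
/- Let k ≤ n and m be positive integers, let W ∈ ℤ^{m×n} be totally unimodular, and let w ∈ ℤᵐ. Let x^l, x^u ∈ ℤⁿ with W x^l ≤ w and W x^u ≤ w, and let x∘ = (x^l + x^u)/2. Then x∘ lies in the convex hull of the set {x ∈ ℤⁿ : Wx ≤ w, ⌊x∘_i⌋ ≤ x_i ≤ ⌈x∘_i⌉ for i = 1,…,k}. -/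
open Matrix Set Filter Topology

theorem Matrix.exists_det_submatrix_ne_zero {K ι κ : Type*} [Field K] [Fintype ι] [Fintype κ]
    [DecidableEq κ] (M : Matrix ι κ K) (hM : Function.Injective M.mulVec) :
    ∃ f : κ → ι, Function.Injective f ∧ (M.submatrix f id).det ≠ 0 := by
  classical
  obtain ⟨σ, a, ha, hspan, hli⟩ := exists_linearIndependent' K M.row
  have : Fintype σ := Fintype.ofInjective a ha
  have hcard : Fintype.card κ = Fintype.card σ := by
    rw [← finrank_span_eq_card hli, hspan, ← M.rank_eq_finrank_span_row, Matrix.rank,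
      LinearMap.finrank_range_of_inj (f := M.mulVecLin) hM, Module.finrank_fintype_fun_eq_card]
  let e := Fintype.equivOfCardEq hcard
  refine ⟨a ∘ e, ha.comp e.injective, ?_⟩
  rw [← isUnit_iff_ne_zero, ← Matrix.isUnit_iff_isUnit_det,
    ← Matrix.linearIndependent_rows_iff_isUnit]
  exact hli.comp e e.injective

/-- The points of the polyhedron `A x ≤ b` in the box `[l, u]`. -/
def boxedPolyhedron {m n : Type*} [Fintype n] (A : Matrix m n ℝ) (b : m → ℝ) (l u : n → ℝ) :
    Set (n → ℝ) :=
  {x | A *ᵥ x ≤ b} ∩ Icc l u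

section

variable {m n : Type*} [Fintype n] {A : Matrix m n ℝ} {b : m → ℝ} {l u : n → ℝ}

theorem isCompact_boxedPolyhedron : IsCompact (boxedPolyhedron A b l u) :=
  isCompact_Icc.inter_left (isClosed_le (by fun_prop) continuous_const)

theorem convex_boxedPolyhedron : Convex ℝ (boxedPolyhedron A b l u) :=
  ((convex_Iic b).is_linear_preimage A.mulVecLin.isLinear).inter (convex_Icc l u)

/-- A direction that vanishes on all constraints active at an extreme point is zero. -/
theorem eq_zero_of_mem_extremePoints_boxedPolyhedron [Finite m] {x v : n → ℝ}
    (hx : x ∈ (boxedPolyhedron A b l u).extremePoints ℝ)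
    (hrow : ∀ j, (A *ᵥ x) j = b j → (A *ᵥ v) j = 0)
    (hcol : ∀ i, ¬(l i < x i ∧ x i < u i) → v i = 0) : v = 0 := by
  obtain ⟨⟨hAx, hlx, hxu⟩, hext⟩ := mem_extremePoints.1 hx
  have hmem : ∀ᶠ t : ℝ in 𝓝 0, x + t • v ∈ boxedPolyhedron A b l u := by
    have hA : ∀ᶠ t : ℝ in 𝓝 0, ∀ j, (A *ᵥ (x + t • v)) j ≤ b j := by
      refine eventually_all.2 fun j => ?_
      simp only [mulVec_add, mulVec_smul, Pi.add_apply, Pi.smul_apply, smul_eq_mul]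
      rcases (hAx j).lt_or_eq with h | h
      · have hc : ContinuousAt (fun t : ℝ => (A *ᵥ x) j + t * (A *ᵥ v) j) 0 := by fun_prop
        exact (hc.eventually_lt_const (by simpa using h)).mono fun t ht => ht.le
      · simp [hrow j h, h]
    have hbox : ∀ᶠ t : ℝ in 𝓝 0, ∀ i, l i ≤ x i + t * v i ∧ x i + t * v i ≤ u i := by
      refine eventually_all.2 fun i => ?_
      by_cases h : l i < x i ∧ x i < u i
      · have hc : ContinuousAt (fun t : ℝ => x i + t * v i) 0 := by fun_prop
        filter_upwards [hc.eventually_lt_const (u := u i) (by simpa using h.2),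
          hc.eventually_const_lt (u := l i) (by simpa using h.1)] with t h₁ h₂
        exact ⟨h₂.le, h₁.le⟩
      · simp [hcol i h, hlx i, hxu i]
    filter_upwards [hA, hbox] with t h₁ h₂
    exact ⟨h₁, fun i => (h₂ i).1, fun i => (h₂ i).2⟩
  obtain ⟨ε, hε, hball⟩ := Metric.eventually_nhds_iff.1 hmem
  have hpos := hball (y := ε / 2) (by simp [abs_of_pos hε, hε])
  have hneg := hball (y := -(ε / 2)) (by simp [abs_of_pos hε, hε])
  have hseg : x ∈ openSegment ℝ (x + (ε / 2) • v) (x + (-(ε / 2)) • v) :=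
    ⟨1 / 2, 1 / 2, by norm_num, by norm_num, by norm_num, by module⟩
  have := (hext _ hpos _ hneg hseg).1
  simpa [hε.ne'] using this

end

/-- Integral version of Cramer's rule for unimodular integer matrices. -/
theorem Matrix.exists_int_eq_of_mulVec_eq {κ : Type*} [Fintype κ] [DecidableEq κ]
    {B : Matrix κ κ ℤ} (hB : IsUnit B.det) {y : κ → ℝ} {z : κ → ℤ}
    (h : B.map (Int.cast : ℤ → ℝ) *ᵥ y = fun i => (z i : ℝ)) (i : κ) : ∃ t : ℤ, y i = t := by
  refine ⟨(B⁻¹ *ᵥ z) i, ?_⟩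
  have hinv : B⁻¹.map (Int.cast : ℤ → ℝ) * B.map (Int.cast : ℤ → ℝ) = 1 := by
    rw [← Matrix.map_mul_intCast, Matrix.nonsing_inv_mul B hB]
    simp
  have hy : y = B⁻¹.map (Int.cast : ℤ → ℝ) *ᵥ fun i => (z i : ℝ) := by
    rw [← h, mulVec_mulVec, hinv, one_mulVec]
  rw [hy]
  simp [mulVec, dotProduct]

theorem Matrix.IsTotallyUnimodular.exists_int_of_mem_extremePoints {m n : Type*} [Fintype m]
    [Fintype n] {W : Matrix m n ℤ} (hW : W.IsTotallyUnimodular) {w : m → ℤ} {l u : n → ℤ}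
    {x : n → ℝ}
    (hx : x ∈ (boxedPolyhedron (W.map (Int.cast : ℤ → ℝ)) (fun j => (w j : ℝ))
      (fun i => (l i : ℝ)) (fun i => (u i : ℝ))).extremePoints ℝ) (i : n) :
    ∃ t : ℤ, x i = t := by
  classical
  obtain ⟨-, hlx, hxu⟩ := hx.1
  let F := {i : n // (l i : ℝ) < x i ∧ x i < u i}
  let T := {j : m // (W.map (Int.cast : ℤ → ℝ) *ᵥ x) j = w j}
  have hint : ∀ i, ¬((l i : ℝ) < x i ∧ x i < u i) → ∃ t : ℤ, x i = t := by
    intro i hi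
    rcases (hlx i).lt_or_eq with h | h
    · exact ⟨u i, le_antisymm (hxu i) (not_lt.1 fun h' => hi ⟨h, h'⟩)⟩
    · exact ⟨l i, h.symm⟩
  let M : Matrix T F ℤ := W.submatrix Subtype.val Subtype.val
  have hM : Function.Injective (M.map (Int.cast : ℤ → ℝ)).mulVec := by
    refine (injective_iff_map_eq_zero (M.map (Int.cast : ℤ → ℝ)).mulVecLin).2 fun v hv => ?_
    let v' : n → ℝ := fun i => if h : (l i : ℝ) < x i ∧ x i < u i then v ⟨i, h⟩ else 0
    have hv' : v' = 0 := by
      refine eq_zero_of_mem_extremePoints_boxedPolyhedron hx (fun j hj => ?_) fun i hi => dif_neg hi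
      have hvj : ∑ i : F, (W j i : ℝ) * v i = 0 := congrFun hv ⟨j, hj⟩
      have hF : ∀ i : F, v' i = v i := fun i => dif_pos i.2
      have hFc : ∀ i : {i // ¬((l i : ℝ) < x i ∧ x i < u i)}, v' i = 0 := fun i => dif_neg i.2
      simp only [mulVec, dotProduct, map_apply]
      rw [← Fintype.sum_subtype_add_sum_subtype (fun i => (l i : ℝ) < x i ∧ x i < u i)]
      simpa [hF, hFc] using hvj
    ext ⟨i, h⟩
    simpa [v', h] using congrFun hv' i
  obtain ⟨f, hf, hdet⟩ := Matrix.exists_det_submatrix_ne_zero _ hM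
  by_cases hi : (l i : ℝ) < x i ∧ x i < u i
  swap
  · exact hint i hi
  have hunit : IsUnit (M.submatrix f id).det := by
    obtain ⟨s, hs⟩ := (isTotallyUnimodular_iff_fintype W).1 hW F (fun a => (f a).1) Subtype.val
    change (s : ℤ) = (M.submatrix f id).det at hs
    rw [submatrix_map, ← Int.cast_det, Int.cast_ne_zero, ← hs] at hdet
    rw [← hs]
    cases s <;> simp at hdet ⊢
  choose! t ht using hint
  refine Matrix.exists_int_eq_of_mulVec_eq hunit (y := fun i : F => x i)
    (z := fun i => w (f i) - ∑ c : {i : n // ¬ ((l i : ℝ) < x i ∧ x i < u i)}, W (f i) c * t c)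
    ?_ ⟨i, hi⟩
  ext a
  have hfa : ∑ i, (W (f a) i : ℝ) * x i = w (f a) := (f a).2
  rw [← Fintype.sum_subtype_add_sum_subtype (fun i => (l i : ℝ) < x i ∧ x i < u i)] at hfa
  have hsum : ∑ i : {i // ¬((l i : ℝ) < x i ∧ x i < u i)}, (W (f a) i : ℝ) * x i =
      ∑ i : {i // ¬((l i : ℝ) < x i ∧ x i < u i)}, (W (f a) i : ℝ) * t i :=
    Finset.sum_congr rfl fun i _ => by rw [ht i i.2]
  rw [hsum] at hfa
  push_cast
  rw [← hfa, add_sub_cancel_right]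
  rfl

theorem Set.finite_Icc_inter_int {n : Type*} [Finite n] (l u : n → ℤ) :
    {x : n → ℝ | (∀ i, ∃ t : ℤ, x i = t) ∧
      x ∈ Icc (fun i => (l i : ℝ)) (fun i => (u i : ℝ))}.Finite := by
  classical
  have := Fintype.ofFinite n
  refine ((finite_Icc l u).image fun z i => (z i : ℝ)).subset ?_
  rintro x ⟨hint, hl, hu⟩
  choose t ht using hint
  obtain rfl : x = fun i => (t i : ℝ) := funext ht
  exact ⟨t, ⟨fun i => Int.cast_le.1 (hl i), fun i => Int.cast_le.1 (hu i)⟩, rfl⟩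

/-- A box-constrained polyhedron with totally unimodular constraint matrix and integral bounds is
the convex hull of its integer points. -/
theorem Matrix.IsTotallyUnimodular.boxedPolyhedron_subset_convexHull {m n : Type*} [Fintype m]
    [Fintype n] {W : Matrix m n ℤ} (hW : W.IsTotallyUnimodular) (w : m → ℤ) (l u : n → ℤ) :
    boxedPolyhedron (W.map (Int.cast : ℤ → ℝ)) (fun j => (w j : ℝ))
        (fun i => (l i : ℝ)) (fun i => (u i : ℝ)) ⊆
      convexHull ℝ {x | (∀ i, ∃ t : ℤ, x i = t) ∧
        x ∈ boxedPolyhedron (W.map (Int.cast : ℤ → ℝ)) (fun j => (w j : ℝ))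
          (fun i => (l i : ℝ)) (fun i => (u i : ℝ))} := by
  refine (closure_convexHull_extremePoints isCompact_boxedPolyhedron
    convex_boxedPolyhedron).symm.subset.trans (closure_minimal (convexHull_mono fun x hx => ?_) ?_)
  · exact ⟨fun i => hW.exists_int_of_mem_extremePoints hx i, hx.1⟩
  · exact ((Set.finite_Icc_inter_int l u).subset fun x hx => ⟨hx.1, hx.2.2⟩).isClosed_convexHull ℝ

/-- the midpoint of two integer points of a TU polyhedron with integral
right-hand side is a convex combination of integer points of the polyhedron whose first `k`
coordinates lie in the unit box around the midpoint. -/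
theorem stmt_10 (k n m : ℕ) (hk : 0 < k) (hkn : k ≤ n) (hm : 0 < m)
    (W : Matrix (Fin m) (Fin n) ℤ)
    (hTU : ∀ (s : ℕ) (r : Fin s → Fin m) (c : Fin s → Fin n),
      Function.Injective r → Function.Injective c →
      (W.submatrix r c).det = 0 ∨ (W.submatrix r c).det = 1 ∨ (W.submatrix r c).det = -1)
    (w : Fin m → ℤ)
    (xl xu : Fin n → ℝ)
    (hxlZ : ∀ i, ∃ z : ℤ, xl i = (z : ℝ)) (hxuZ : ∀ i, ∃ z : ℤ, xu i = (z : ℝ))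
    (hxl : ∀ j, (∑ i, (W j i : ℝ) * xl i) ≤ (w j : ℝ))
    (hxu : ∀ j, (∑ i, (W j i : ℝ) * xu i) ≤ (w j : ℝ))
    (x0 : Fin n → ℝ) (hx0 : x0 = fun i => (xl i + xu i) / 2) :
    x0 ∈ convexHull ℝ {x : Fin n → ℝ | (∀ i, ∃ z : ℤ, x i = (z : ℝ)) ∧
      (∀ j, (∑ i, (W j i : ℝ) * x i) ≤ (w j : ℝ)) ∧
      (∀ i : Fin k, (⌊x0 (Fin.castLE hkn i)⌋ : ℝ) ≤ x (Fin.castLE hkn i) ∧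
        x (Fin.castLE hkn i) ≤ (⌈x0 (Fin.castLE hkn i)⌉ : ℝ))} := by
  have hW : W.IsTotallyUnimodular := by
    intro s r c hr hc
    rcases hTU s r c hr hc with h | h | h
    · exact ⟨0, by simp [h]⟩
    · exact ⟨1, by simp [h]⟩
    · exact ⟨-1, by simp [h]⟩
  refine convexHull_mono ?_ (hW.boxedPolyhedron_subset_convexHull w (fun i => ⌊x0 i⌋)
    (fun i => ⌈x0 i⌉) ⟨fun j => ?_, fun i => Int.floor_le _, fun i => Int.le_ceil _⟩)
  · rintro x ⟨hint, hA, hl, hu⟩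
    exact ⟨hint, hA, fun i => ⟨hl _, hu _⟩⟩
  · have hmid : ∑ i, (W j i : ℝ) * x0 i =
        (∑ i, (W j i : ℝ) * xl i + ∑ i, (W j i : ℝ) * xu i) / 2 := by
      rw [hx0, ← Finset.sum_add_distrib, Finset.sum_div]
      exact Finset.sum_congr rfl fun i _ => by ring
    change ∑ i, (W j i : ℝ) * x0 i ≤ w j
    linarith [hxl j, hxu j]
end

section
/- Let k ≤ n and m be positive integers, let W ∈ ℤ^{m×n} be totally unimodular, and let w ∈ ℤᵐ. Let S = {x ∈ ℤⁿ : Wx ≤ w}, let q₁,…,q_k > 0 and h ∈ ℝⁿ, and define f(x) = Σ_{i=1}^k (−q_i x_i²) + Σ_{i=1}^n h_i x_i. For each i = 1,…,k suppose l_i = min{x_i : x ∈ S} and u_i = max{x_i : x ∈ S} exist, let g > 0 be a real number with u_i − l_i ≥ g for all i = 1,…,k, and let γ = max{q_i(u_i − l_i)² : i = 1,…,k}, attained at an index i₀. Let x^l, x^u ∈ S with x^l_{i₀} = l_{i₀} and x^u_{i₀} = u_{i₀}, and let x∘ = (x^l + x^u)/2. Then there exists x^Υ ∈ S with f(x∘)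 − f(x^Υ) ≤ γ k / (4g²). -/
/-- A matrix over a field with injective `mulVec` has an invertible square submatrix
using all columns. -/
lemma Matrix.exists_det_submatrix_ne_zero_s11 {ι K : Type*} [Field K] [Finite ι] {n : ℕ}
    (A : Matrix ι (Fin n) K) (hA : Function.Injective A.mulVec) :
    ∃ r : Fin n → ι, (A.submatrix r id).det ≠ 0 := by
  have hrank : Module.finrank K (Submodule.span K (Set.range A.row)) = n := by
    have hcol := Matrix.mulVec_injective_iff.mp hA
    rw [← A.rank_eq_finrank_span_row, A.rank_eq_finrank_span_cols, finrank_span_eq_card hcol,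
      Fintype.card_fin]
  have hex := Submodule.exists_fun_fin_finrank_span_eq K (Set.range A.row)
  rw [hrank] at hex
  obtain ⟨v, hv, -, hli⟩ := hex
  choose r hr using hv
  refine ⟨r, ?_⟩
  have hrow : (A.submatrix r id).row = v := funext hr
  rw [← hrow, Matrix.linearIndependent_rows_iff_isUnit, Matrix.isUnit_iff_isUnit_det] at hli
  exact hli.ne_zero

/-- A point at which a family of rows of a totally unimodular matrix with trivial common kernel
takes integral values is integral. -/
lemma Matrix.IsTotallyUnimodular.exists_int_of_rows_integral {ι : Type*} [Finite ι] {n : ℕ}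
    {A : Matrix ι (Fin n) ℤ} (hA : A.IsTotallyUnimodular) (T : Set ι)
    (hT : ∀ d : Fin n → ℝ, (∀ j ∈ T, (A.map (Int.cast : ℤ → ℝ)).mulVec d j = 0) → d = 0)
    (x : Fin n → ℝ) (hx : ∀ j ∈ T, ∃ z : ℤ, (A.map (Int.cast : ℤ → ℝ)).mulVec x j = z) :
    ∃ y : Fin n → ℤ, x = fun i => (y i : ℝ) := by
  let B : Matrix T (Fin n) ℤ := A.submatrix Subtype.val id
  have hB : Function.Injective (B.map (Int.cast : ℤ → ℝ)).mulVec := by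
    refine (injective_iff_map_eq_zero (B.map (Int.cast : ℤ → ℝ)).mulVecLin).mpr fun d hd => ?_
    exact hT d fun j hj => congrFun hd ⟨j, hj⟩
  obtain ⟨r, hr⟩ := Matrix.exists_det_submatrix_ne_zero_s11 _ hB
  let C : Matrix (Fin n) (Fin n) ℤ := B.submatrix r id
  have hCmap : (B.map (Int.cast : ℤ → ℝ)).submatrix r id = C.map (Int.castRingHom ℝ) := rfl
  rw [hCmap] at hr
  have hdet : (C.map (Int.castRingHom ℝ)).det = (C.det : ℝ) :=
    ((Int.castRingHom ℝ).map_det C).symm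
  have hC0 : C.det ≠ 0 := by
    intro h0
    rw [hdet, h0] at hr
    simp at hr
  have hCunit : IsUnit C.det := by
    obtain ⟨s, hs⟩ := (Matrix.isTotallyUnimodular_iff A).mp hA n (fun i => (r i : ι)) id
    change (s : ℤ) = C.det at hs
    rw [← hs] at hC0 ⊢
    cases s
    · exact absurd rfl hC0
    · exact isUnit_one.neg
    · exact isUnit_one
  choose c hc using fun i => hx (r i) (r i).2
  refine ⟨C⁻¹.mulVec c, ?_⟩
  have hCx : (C.map (Int.castRingHom ℝ)).mulVec x = fun i => (c i : ℝ) := funext hc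
  have hCy : (C.map (Int.castRingHom ℝ)).mulVec (fun i => ((C⁻¹.mulVec c) i : ℝ)) =
      fun i => (c i : ℝ) := by
    funext i
    have h1 : C.mulVec (C⁻¹.mulVec c) i = c i := by
      rw [Matrix.mulVec_mulVec, Matrix.mul_nonsing_inv _ hCunit, Matrix.one_mulVec]
    rw [← h1]
    exact ((Int.castRingHom ℝ).map_mulVec C (C⁻¹.mulVec c) i).symm
  refine Matrix.mulVec_injective_of_isUnit ?_ (hCx.trans hCy.symm)
  rw [Matrix.isUnit_iff_isUnit_det]
  exact hr.isUnit

/-- A vector with a nonintegral entry can be moved along a direction supported on its nonintegral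
entries, without leaving the unit cells of its entries, until another entry becomes integral. -/
lemma exists_smul_add_integral {ι : Type*} [Fintype ι] (a d : ι → ℝ) (hd : d ≠ 0)
    (had : ∀ j, a j = ⌊a j⌋ → d j = 0) :
    ∃ t : ℝ, (∀ j, (⌊a j⌋ : ℝ) ≤ a j + t * d j ∧ a j + t * d j ≤ ⌈a j⌉) ∧
      ∃ j, a j ≠ ⌊a j⌋ ∧ a j + t * d j = ⌊a j + t * d j⌋ := by
  classical
  let e : ι → ℝ := fun j => if 0 < d j then (⌈a j⌉ : ℝ) else ⌊a j⌋
  let τ : ι → ℝ := fun j => (e j - a j) / d j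
  obtain ⟨j₁, hj₁⟩ := Function.ne_iff.mp hd
  obtain ⟨j₀, hj₀, hmin⟩ := (Finset.univ.filter fun j => d j ≠ 0).exists_min_image τ
    ⟨j₁, by simpa using hj₁⟩
  have hj₀ : d j₀ ≠ 0 := by simpa using hj₀
  have hτ : 0 ≤ τ j₀ := by
    simp only [τ, e]
    split_ifs with h
    · exact div_nonneg (sub_nonneg.mpr (Int.le_ceil _)) h.le
    · exact div_nonneg_of_nonpos (sub_nonpos.mpr (Int.floor_le _)) (not_lt.mp h)
  refine ⟨τ j₀, fun j => ?_, j₀, fun h => hj₀ (had _ h), ?_⟩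
  · have h1 := Int.floor_le (a j)
    have h2 := Int.le_ceil (a j)
    by_cases hdj : d j = 0
    · simp [hdj, h1, h2]
    have hle := hmin j (by simpa using hdj)
    rcases lt_or_gt_of_ne hdj with hneg | hpos
    · have : τ j * d j = ⌊a j⌋ - a j := by
        simp [τ, e, not_lt.mpr hneg.le, div_mul_cancel₀ _ hdj]
      constructor <;> nlinarith
    · have : τ j * d j = ⌈a j⌉ - a j := by
        simp [τ, e, hpos, div_mul_cancel₀ _ hdj]
      constructor <;> nlinarith
  · have : a j₀ + τ j₀ * d j₀ = e j₀ := by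
      simp [τ, div_mul_cancel₀ _ hj₀]
    rw [this]
    simp only [e]
    split_ifs <;> simp

/-- Rounding for totally unimodular matrices with trivial kernel: every real point can be replaced
by an integral one whose row values stay between the floors and ceilings of the original ones. -/
lemma Matrix.IsTotallyUnimodular.exists_int_rounding {ι : Type*} [Fintype ι] {n : ℕ}
    {A : Matrix ι (Fin n) ℤ} (hA : A.IsTotallyUnimodular)
    (hinj : Function.Injective (A.map (Int.cast : ℤ → ℝ)).mulVec) (x : Fin n → ℝ) :
    ∃ y : Fin n → ℤ, ∀ j, ⌊(A.map (Int.cast : ℤ → ℝ)).mulVec x j⌋ ≤ A.mulVec y j ∧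
      A.mulVec y j ≤ ⌈(A.map (Int.cast : ℤ → ℝ)).mulVec x j⌉ := by
  classical
  induction hN : (Finset.univ.filter fun j =>
      (A.map (Int.cast : ℤ → ℝ)).mulVec x j ≠ ⌊(A.map (Int.cast : ℤ → ℝ)).mulVec x j⌋).card
    using Nat.strong_induction_on generalizing x with
  | _ N ih =>
    set M : Matrix ι (Fin n) ℝ := A.map (Int.cast : ℤ → ℝ)
    by_cases hT : ∀ d : Fin n → ℝ, (∀ j ∈ {j | M.mulVec x j = ⌊M.mulVec x j⌋},
        M.mulVec d j = 0) → d = 0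
    · obtain ⟨y, rfl⟩ := hA.exists_int_of_rows_integral _ hT x fun j hj => ⟨_, hj⟩
      refine ⟨y, fun j => ?_⟩
      have h1 : M.mulVec (fun i => (y i : ℝ)) j = (A.mulVec y j : ℤ) :=
        ((Int.castRingHom ℝ).map_mulVec A y j).symm
      simp [h1]
    · push Not at hT
      obtain ⟨d, hd, hd0⟩ := hT
      have hMd : M.mulVec d ≠ 0 := fun h0 => hd0 (hinj (h0.trans M.mulVec_zero.symm))
      obtain ⟨t, ht, j₀, hj₀, hj₀'⟩ := exists_smul_add_integral (M.mulVec x) (M.mulVec d) hMd hd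
      have hval : ∀ j, M.mulVec (x + t • d) j = M.mulVec x j + t * M.mulVec d j := fun j => by
        simp [Matrix.mulVec_add, Matrix.mulVec_smul]
      obtain ⟨y, hy⟩ := ih _ (by
        rw [← hN]
        refine Finset.card_lt_card (Finset.ssubset_iff_of_subset ?_ |>.mpr ⟨j₀, ?_, ?_⟩)
        · intro j
          simp only [Finset.mem_filter, Finset.mem_univ, true_and, hval]
          refine mt fun h => ?_
          rw [hd j h, mul_zero, add_zero]
          exact h
        · simpa using hj₀
        · simpa only [Finset.mem_filter, Finset.mem_univ, true_and, hval, not_not] using hj₀')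
        (x + t • d) rfl
      refine ⟨y, fun j => ⟨le_trans ?_ (hy j).1, (hy j).2.trans ?_⟩⟩
      · rw [hval]
        exact Int.le_floor.mpr (ht j).1
      · rw [hval]
        exact Int.ceil_le.mpr (ht j).2

lemma two_mul_near_of_floor_le_of_le_ceil {a b : ℤ} (h1 : ⌊(a : ℝ) / 2⌋ ≤ b)
    (h2 : b ≤ ⌈(a : ℝ) / 2⌉) : a - 1 ≤ 2 * b ∧ 2 * b ≤ a + 1 := by
  have h3 : (a : ℝ) / 2 < b + 1 := (Int.lt_floor_add_one _).trans_le (by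
    have : (⌊(a : ℝ) / 2⌋ : ℝ) ≤ b := Int.cast_le.mpr h1
    linarith)
  have h4 : (b : ℝ) - 1 < a / 2 := by
    have : (b : ℝ) ≤ ⌈(a : ℝ) / 2⌉ := by exact_mod_cast h2
    linarith [Int.ceil_lt_add_one ((a : ℝ) / 2)]
  have h5 : a < 2 * b + 2 := by exact_mod_cast (by linarith : (a : ℝ) < 2 * b + 2)
  have h6 : 2 * b - 2 < a := by exact_mod_cast (by linarith : 2 * (b : ℝ) - 2 < a)
  omega

/-- Equitable halving for totally unimodular matrices: an integral vector `s` has an integral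
near-half `y` such that `W *ᵥ y` is a near-half of `W *ᵥ s`. -/
lemma Matrix.IsTotallyUnimodular.exists_near_half {ι : Type*} [Fintype ι] {n : ℕ}
    {W : Matrix ι (Fin n) ℤ} (hW : W.IsTotallyUnimodular) (s : Fin n → ℤ) :
    ∃ y : Fin n → ℤ, (∀ i, s i - 1 ≤ 2 * y i ∧ 2 * y i ≤ s i + 1) ∧
      ∀ j, W.mulVec s j - 1 ≤ 2 * W.mulVec y j ∧ 2 * W.mulVec y j ≤ W.mulVec s j + 1 := by
  let A := Matrix.fromRows W (1 : Matrix (Fin n) (Fin n) ℤ)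
  have hA : A.IsTotallyUnimodular := (Matrix.fromRows_one_isTotallyUnimodular_iff W).mpr hW
  have hl : ∀ v : Fin n → ℤ, ∀ j, A.mulVec v (Sum.inl j) = W.mulVec v j := fun v j => by
    simp [A, Matrix.fromRows_mulVec]
  have hr : ∀ v : Fin n → ℤ, ∀ i, A.mulVec v (Sum.inr i) = v i := fun v i => by
    simp [A, Matrix.fromRows_mulVec]
  have hinj : Function.Injective (A.map (Int.cast : ℤ → ℝ)).mulVec := by
    intro v v' h
    have hmap : A.map (Int.cast : ℤ → ℝ) =
        Matrix.fromRows (W.map (Int.cast : ℤ → ℝ)) (1 : Matrix (Fin n) (Fin n) ℝ) := by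
      ext (j | i) i'
      · rfl
      · simp [A, Matrix.one_apply]
    funext i
    simpa [hmap, Matrix.fromRows_mulVec] using congrFun h (Sum.inr i)
  obtain ⟨y, hy⟩ := hA.exists_int_rounding hinj ((2⁻¹ : ℝ) • fun i => (s i : ℝ))
  have hval : ∀ j, (A.map (Int.cast : ℤ → ℝ)).mulVec ((2⁻¹ : ℝ) • fun i => (s i : ℝ)) j =
      (A.mulVec s j : ℝ) / 2 := fun j => by
    rw [Matrix.mulVec_smul, Pi.smul_apply, smul_eq_mul, div_eq_inv_mul]
    exact congrArg _ ((Int.castRingHom ℝ).map_mulVec A s j).symm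
  have key := fun j => two_mul_near_of_floor_le_of_le_ceil (hval j ▸ (hy j).1) (hval j ▸ (hy j).2)
  refine ⟨y, fun i => ?_, fun j => ?_⟩
  · simpa only [hr] using key (Sum.inr i)
  · simpa only [hl] using key (Sum.inl j)

/-- TU case: there is an integer point `x^Υ` of the polyhedron whose objective
value is within `γ k / (4g²)` of the value at the midpoint `x∘`. -/
theorem stmt_11 (k n m : ℕ) (hk : 0 < k) (hkn : k ≤ n) (hm : 0 < m)
    (W : Matrix (Fin m) (Fin n) ℤ)
    (hTU : ∀ (s : ℕ) (r : Fin s → Fin m) (c : Fin s → Fin n),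
      Function.Injective r → Function.Injective c →
      (W.submatrix r c).det = 0 ∨ (W.submatrix r c).det = 1 ∨ (W.submatrix r c).det = -1)
    (w : Fin m → ℤ)
    (S : Set (Fin n → ℝ))
    (hS : S = {x | (∀ i, ∃ z : ℤ, x i = (z : ℝ)) ∧
                   ∀ j, (∑ i, (W j i : ℝ) * x i) ≤ (w j : ℝ)})
    (q : Fin k → ℝ) (hq : ∀ i, 0 < q i) (h : Fin n → ℝ)
    (f : (Fin n → ℝ) → ℝ)
    (hf : ∀ x, f x = (∑ i : Fin k, -(q i) * (x (Fin.castLE hkn i)) ^ 2) + ∑ i, h i * x i)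
    (l u : Fin k → ℝ)
    (hl : ∀ i, (∃ y ∈ S, y (Fin.castLE hkn i) = l i) ∧ ∀ y ∈ S, l i ≤ y (Fin.castLE hkn i))
    (hu : ∀ i, (∃ y ∈ S, y (Fin.castLE hkn i) = u i) ∧ ∀ y ∈ S, y (Fin.castLE hkn i) ≤ u i)
    (g : ℝ) (hg : 0 < g) (hgap : ∀ i, g ≤ u i - l i)
    (γ : ℝ) (i₀ : Fin k)
    (hγmax : ∀ i, q i * (u i - l i) ^ 2 ≤ γ) (hγatt : γ = q i₀ * (u i₀ - l i₀) ^ 2)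
    (xl xu : Fin n → ℝ) (hxl : xl ∈ S) (hxu : xu ∈ S)
    (hxli : xl (Fin.castLE hkn i₀) = l i₀) (hxui : xu (Fin.castLE hkn i₀) = u i₀)
    (x0 : Fin n → ℝ) (hx0 : x0 = fun i => (xl i + xu i) / 2) :
    ∃ xY ∈ S, f x0 - f xY ≤ γ * k / (4 * g ^ 2) := by
  have hW : W.IsTotallyUnimodular := by
    intro s r c hr hc
    rcases hTU s r c hr hc with h | h | h
    · exact ⟨0, by simp [h]⟩
    · exact ⟨1, by simp [h]⟩
    · exact ⟨-1, by simp [h]⟩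
  have hmem : ∀ v : Fin n → ℤ, (∀ j, W.mulVec v j ≤ w j) ↔ (fun i => (v i : ℝ)) ∈ S := by
    intro v
    rw [hS]
    refine ⟨fun hv => ⟨fun i => ⟨v i, rfl⟩, fun j => ?_⟩, fun hv j => ?_⟩
    · have := hv j
      simp only [Matrix.mulVec, dotProduct] at this
      beta_reduce
      exact_mod_cast this
    · have := hv.2 j
      beta_reduce at this
      simp only [Matrix.mulVec, dotProduct]
      exact_mod_cast this
  have hint : ∀ x ∈ S, ∃ v : Fin n → ℤ, x = fun i => (v i : ℝ) := by
    intro x hx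
    rw [hS] at hx
    choose v hv using hx.1
    exact ⟨v, funext hv⟩
  obtain ⟨a, rfl⟩ := hint xl hxl
  obtain ⟨b, rfl⟩ := hint xu hxu
  rw [← hmem] at hxl hxu
  obtain ⟨y, hy, hWy⟩ := hW.exists_near_half (a + b)
  have hyS : (fun i => (y i : ℝ)) ∈ S := by
    rw [← hmem]
    intro j
    have h1 := hWy j
    rw [Matrix.mulVec_add, Pi.add_apply] at h1
    have := hxl j
    have := hxu j
    omega
  have hzS : (fun i => ((a + b - y) i : ℝ)) ∈ S := by
    rw [← hmem]
    intro j
    have h1 := hWy j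
    rw [Matrix.mulVec_sub, Pi.sub_apply]
    rw [Matrix.mulVec_add, Pi.add_apply] at h1 ⊢
    have := hxl j
    have := hxu j
    omega
  have hq4 : ∀ i, q i ≤ γ / g ^ 2 := by
    intro i
    rw [le_div_iff₀ (by positivity)]
    refine le_trans ?_ (hγmax i)
    have := hgap i
    have := hq i
    gcongr
  have hid : f x0 - (f (fun i => (y i : ℝ)) + f (fun i => ((a + b - y) i : ℝ))) / 2 =
      ∑ i : Fin k, q i * ((y (Fin.castLE hkn i) : ℝ) - x0 (Fin.castLE hkn i)) ^ 2 := by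
    have hlin : ∑ i, h i * x0 i =
        (∑ i, h i * (y i : ℝ) + ∑ i, h i * ((a + b - y) i : ℝ)) / 2 := by
      rw [← Finset.sum_add_distrib, Finset.sum_div]
      refine Finset.sum_congr rfl fun i _ => ?_
      simp only [hx0, Pi.sub_apply, Pi.add_apply]
      push_cast
      ring
    have hquad : ∑ i : Fin k, -(q i) * (x0 (Fin.castLE hkn i)) ^ 2 =
        (∑ i : Fin k, -(q i) * (y (Fin.castLE hkn i) : ℝ) ^ 2 +
          ∑ i : Fin k, -(q i) * ((a + b - y) (Fin.castLE hkn i) : ℝ) ^ 2) / 2 +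
        ∑ i : Fin k, q i * ((y (Fin.castLE hkn i) : ℝ) - x0 (Fin.castLE hkn i)) ^ 2 := by
      rw [← Finset.sum_add_distrib, Finset.sum_div, ← Finset.sum_add_distrib]
      refine Finset.sum_congr rfl fun i _ => ?_
      simp only [hx0, Pi.sub_apply, Pi.add_apply]
      push_cast
      ring
    rw [hf, hf, hf, hlin, hquad]
    ring
  have hbound : ∑ i : Fin k, q i * ((y (Fin.castLE hkn i) : ℝ) - x0 (Fin.castLE hkn i)) ^ 2 ≤
      γ * k / (4 * g ^ 2) := by
    have hterm : ∀ i : Fin k, q i * ((y (Fin.castLE hkn i) : ℝ) - x0 (Fin.castLE hkn i)) ^ 2 ≤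
        γ / g ^ 2 * (1 / 4) := by
      intro i
      obtain ⟨h1, h2⟩ := hy (Fin.castLE hkn i)
      rw [Pi.add_apply] at h1 h2
      have h1 : (a (Fin.castLE hkn i) + b (Fin.castLE hkn i) - 1 : ℝ) ≤
        2 * y (Fin.castLE hkn i) := by exact_mod_cast h1
      have h2 : 2 * (y (Fin.castLE hkn i) : ℝ) ≤
        a (Fin.castLE hkn i) + b (Fin.castLE hkn i) + 1 := by exact_mod_cast h2
      have hsq : ((y (Fin.castLE hkn i) : ℝ) - x0 (Fin.castLE hkn i)) ^ 2 ≤ 1 / 4 := by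
        rw [hx0]
        nlinarith
      exact mul_le_mul (hq4 i) hsq (sq_nonneg _) ((hq i).le.trans (hq4 i))
    refine (Finset.sum_le_sum fun i _ => hterm i).trans_eq ?_
    rw [Finset.sum_const, Finset.card_univ, Fintype.card_fin, nsmul_eq_mul]
    field_simp
  rcases le_total (f fun i => (y i : ℝ)) (f fun i => ((a + b - y) i : ℝ)) with hle | hle
  · exact ⟨_, hzS, by linarith⟩
  · exact ⟨_, hyS, by linarith⟩
end

section
/- Let k ≤ n and m be positive integers, let W ∈ ℤ^{m×n} be totally unimodular, and let w ∈ ℤᵐ. Let S = {x ∈ ℤⁿ : Wx ≤ w}, let q₁,…,q_k > 0 and h ∈ ℝⁿ, and define f(x) = Σ_{i=1}^k (−q_i x_i²) + Σ_{i=1}^n h_i x_i. Suppose x* ∈ S satisfies f(x*) ≤ f(x) for all x ∈ S. For each i = 1,…,k suppose l_i = min{x_i : x ∈ S} and u_i = max{x_i : x ∈ S} exist, let g > 0 be a real number with u_i − l_i ≥ g for all i = 1,…,k, and let γ = max{q_i(u_i − l_i)² : i = 1,…,k}. Then there exists x^Υ ∈ S with f(x^Υ) − f(x*) ≥ γ (g²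 − k) / (4g²). -/
/-- A matrix with trivial kernel over a field has a nonsingular square submatrix that uses all
columns. -/
theorem Matrix.exists_submatrix_det_ne_zero {K m : Type*} [Field K] [Finite m] {c : ℕ}
    (A : Matrix m (Fin c) K) (hA : ∀ x, A.mulVec x = 0 → x = 0) :
    ∃ r : Fin c → m, (A.submatrix r id).det ≠ 0 := by
  cases nonempty_fintype m
  have hrank : Module.finrank K (Submodule.span K (Set.range A.row)) = c := by
    rw [← A.rank_eq_finrank_span_row, Matrix.rank, LinearMap.finrank_range_of_inj]
    · simp
    · exact (injective_iff_map_eq_zero A.mulVecLin).2 hA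
  obtain ⟨f, hf, -, hind⟩ := Submodule.exists_fun_fin_finrank_span_eq K (Set.range A.row)
  choose r hr using hf
  refine ⟨r ∘ Fin.cast hrank.symm, ?_⟩
  have hrow : (A.submatrix (r ∘ Fin.cast hrank.symm) id).row = f ∘ Fin.cast hrank.symm :=
    funext fun i => hr _
  replace hind := hind.comp _ (Fin.cast_injective hrank.symm)
  rw [← hrow, Matrix.linearIndependent_rows_iff_isUnit, Matrix.isUnit_iff_isUnit_det] at hind
  exact hind.ne_zero

theorem Matrix.IsTotallyUnimodular.det_eq {m n : Type*} {A : Matrix m n ℤ}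
    (hA : A.IsTotallyUnimodular) {s : ℕ} (r : Fin s → m) (c : Fin s → n) :
    (A.submatrix r c).det = 0 ∨ (A.submatrix r c).det = 1 ∨ (A.submatrix r c).det = -1 := by
  obtain ⟨t, ht⟩ := (Matrix.isTotallyUnimodular_iff A).1 hA s r c
  rw [← ht]
  cases t <;> simp

/-- If the columns of a totally unimodular matrix form a circuit modulo two, then some signing of
the columns sums to zero. -/
theorem Matrix.IsTotallyUnimodular.exists_signing_of_circuit {m : Type*} [Finite m] {c : ℕ}
    {A : Matrix m (Fin (c + 1)) ℤ} (hA : A.IsTotallyUnimodular)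
    (hker : ∀ x : Fin (c + 1) → ZMod 2,
      (∀ i, ∑ j, (A i j : ZMod 2) * x j = 0) ↔ x = 0 ∨ x = 1) :
    ∃ v : Fin (c + 1) → ℤ, (∀ j, v j = 1 ∨ v j = -1) ∧ ∀ i, ∑ j, A i j * v j = 0 := by
  have hcast : ∀ {s : ℕ} (r : Fin s → m) (d : Fin s → Fin (c + 1)),
      ((A.submatrix r d).det : ZMod 2) = (((A.map (Int.cast : ℤ → ZMod 2))).submatrix r d).det := by
    intro s r d
    exact (Int.castRingHom (ZMod 2)).map_det (A.submatrix r d)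
  obtain ⟨r, hr⟩ := Matrix.exists_submatrix_det_ne_zero
    ((A.map (Int.cast : ℤ → ZMod 2)).submatrix id Fin.succ) (by
      intro x hx
      have := (hker (Fin.cons 0 x)).1 (fun i => by
        simpa [Fin.sum_univ_succ, Matrix.mulVec, dotProduct] using congrFun hx i)
      rcases this with h | h
      · funext j
        simpa using congrFun h j.succ
      · simpa using congrFun h 0)
  rw [Matrix.submatrix_submatrix] at hr
  let v : Fin (c + 1) → ℤ := fun j => (-1) ^ (j : ℕ) * (A.submatrix r j.succAbove).det
  have hexp : ∀ i, ∑ j, A i j * v j =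
      (A.submatrix (Fin.cons i r : Fin (c + 1) → m) id).det := by
    intro i
    rw [Matrix.det_succ_row_zero]
    refine Finset.sum_congr rfl fun j _ => ?_
    simp only [v, Matrix.submatrix_submatrix, Matrix.submatrix_apply, Fin.cons_zero, id_eq]
    have : (Fin.cons i r : Fin (c + 1) → m) ∘ Fin.succ = r := by
      funext a
      simp
    rw [this]
    simp only [Function.id_comp]
    ring
  have hdet : ∀ i, (A.submatrix (Fin.cons i r : Fin (c + 1) → m) id).det = 0 := by
    intro i
    have h0 : ((A.submatrix (Fin.cons i r : Fin (c + 1) → m) id).det : ZMod 2) = 0 := by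
      rw [hcast, ← Matrix.exists_mulVec_eq_zero_iff]
      refine ⟨1, one_ne_zero, ?_⟩
      funext a
      simpa [Matrix.mulVec, dotProduct] using
        (hker 1).2 (Or.inr rfl) ((Fin.cons i r : Fin (c + 1) → m) a)
    rcases hA.det_eq (Fin.cons i r : Fin (c + 1) → m) id with h | h | h
    · exact h
    · rw [h] at h0; simp at h0
    · rw [h] at h0; simp at h0
  have hv : ∀ i, ∑ j, A i j * v j = 0 := fun i => (hexp i).trans (hdet i)
  have hv2 : (fun j => (v j : ZMod 2)) = 0 ∨ (fun j => (v j : ZMod 2)) = 1 := by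
    rw [← hker]
    intro i
    have := congrArg (Int.cast : ℤ → ZMod 2) (hv i)
    simpa using this
  have hone : ∀ j, (v j : ZMod 2) = 1 := by
    rcases hv2 with h | h
    · exfalso
      have h0 := congrFun h 0
      simp only [v, Fin.val_zero, pow_zero, one_mul, Pi.zero_apply, hcast] at h0
      exact hr h0
    · exact fun j => congrFun h j
  refine ⟨v, fun j => ?_, hv⟩
  have hj := hone j
  rcases neg_one_pow_eq_or ℤ (j : ℕ) with hs | hs <;>
  rcases hA.det_eq r j.succAbove with h | h | h <;>
  simp [v, hs, h] at hj ⊢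

/-- Camion's signing theorem: if all row sums of a totally unimodular matrix are even, then some
signing of the columns sums to zero. -/
theorem Matrix.IsTotallyUnimodular.exists_signing {m n : Type*} [Finite m] [Fintype n]
    {A : Matrix m n ℤ} (hA : A.IsTotallyUnimodular)
    (hsum : ∀ i, ∑ j, (A i j : ZMod 2) = 0) :
    ∃ v : n → ℤ, (∀ j, v j = 1 ∨ v j = -1) ∧ ∀ i, ∑ j, A i j * v j = 0 := by
  induction hcard : Fintype.card n using Nat.strong_induction_on generalizing n with
  | _ N ih =>
  by_cases hker : ∀ x : n → ZMod 2,
      (∀ i, ∑ j, (A i j : ZMod 2) * x j = 0) → x = 0 ∨ x = 1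
  · rcases N with _ | c
    · have := Fintype.card_eq_zero_iff.1 hcard
      exact ⟨0, fun j => isEmptyElim j, fun i => by simp⟩
    · let e : Fin (c + 1) ≃ n := (Fintype.equivFinOfCardEq hcard).symm
      obtain ⟨v, hv, hv0⟩ := (hA.submatrix id e).exists_signing_of_circuit (fun x => by
        constructor
        · intro hx
          have := hker (x ∘ e.symm) (fun i => by
            rw [← hx i, ← e.sum_comp]
            simp)
          rcases this with h | h
          · left
            funext j
            simpa using congrFun h (e j)
          · right
            funext j
            simpa using congrFun h (e j)
        · rintro (rfl | rfl) i
          · simp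
          · simpa [← e.sum_comp] using hsum i)
      refine ⟨v ∘ e.symm, fun j => hv _, fun i => ?_⟩
      rw [← hv0 i, ← e.sum_comp]
      simp
  · push Not at hker
    obtain ⟨x, hx, hx0, hx1⟩ := hker
    classical
    let p : n → Prop := fun j => x j = 1
    have hne : ∀ j, ¬ p j → x j = 0 := fun j hj =>
      (by decide : ∀ a : ZMod 2, a ≠ 1 → a = 0) _ hj
    have hp : ∀ i, ∑ j : {j // p j}, (A i j : ZMod 2) = 0 := by
      intro i
      have h1 : ∑ j : {j // p j}, (A i j : ZMod 2) * x j = ∑ j : {j // p j}, (A i j : ZMod 2) :=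
        Finset.sum_congr rfl fun j _ => by rw [show x j = 1 from j.2, mul_one]
      have h2 : ∑ j : {j // ¬ p j}, (A i j : ZMod 2) * x j = 0 :=
        Finset.sum_eq_zero fun j _ => by rw [hne j j.2, mul_zero]
      rw [← hx i, ← Fintype.sum_subtype_add_sum_subtype p, h1, h2, add_zero]
    have hnp : ∀ i, ∑ j : {j // ¬ p j}, (A i j : ZMod 2) = 0 := by
      intro i
      have := Fintype.sum_subtype_add_sum_subtype p fun j => (A i j : ZMod 2)
      rwa [hp, hsum, zero_add] at this
    obtain ⟨j₀, hj₀⟩ := Function.ne_iff.1 hx0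
    obtain ⟨j₁, hj₁⟩ := Function.ne_iff.1 hx1
    obtain ⟨v, hv, hv0⟩ := ih _
      (hcard ▸ Fintype.card_subtype_lt (p := p) (x := j₁) hj₁)
      (hA.submatrix id (Subtype.val : {j // p j} → n)) hp rfl
    obtain ⟨v', hv', hv0'⟩ := ih _
      (hcard ▸ Fintype.card_subtype_lt (p := fun j => ¬ p j) (x := j₀)
        (not_not_intro (not_imp_comm.1 (hne j₀) hj₀)))
      (hA.submatrix id (Subtype.val : {j // ¬ p j} → n)) hnp rfl
    refine ⟨fun j => if hj : p j then v ⟨j, hj⟩ else v' ⟨j, hj⟩, fun j => ?_, fun i => ?_⟩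
    · dsimp only
      split_ifs
      exacts [hv _, hv' _]
    · rw [← Fintype.sum_subtype_add_sum_subtype p]
      refine (congrArg₂ (· + ·) ?_ ?_).trans (add_zero 0)
      · rw [← hv0 i]
        exact Finset.sum_congr rfl fun j _ => congrArg (A i j * ·) (dif_pos j.2)
      · rw [← hv0' i]
        exact Finset.sum_congr rfl fun j _ => congrArg (A i j * ·) (dif_neg j.2)

/-- Equitable signing (Ghouila-Houri): any set of columns of a totally unimodular matrix, given here
as the odd entries of `d`, can be signed such that all row sums lie in `{-1, 0, 1}`. -/
theorem Matrix.IsTotallyUnimodular.exists_equitable_signing {m n : Type*} [Finite m] [Fintype n]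
    {A : Matrix m n ℤ} (hA : A.IsTotallyUnimodular) (d : n → ℤ) :
    ∃ σ : n → ℤ, (∀ j, |σ j| ≤ 1) ∧ (∀ j, (2 : ℤ) ∣ d j - σ j) ∧
      ∀ i, |∑ j, A i j * σ j| ≤ 1 := by
  classical
  cases nonempty_fintype m
  let e : n ⊕ m → ZMod 2 := Sum.elim (fun j => d j) (fun i => ∑ j, (A i j : ZMod 2) * d j)
  let p : n ⊕ m → Prop := fun a => e a = 1
  have he : ∀ a, e a = if p a then 1 else 0 := fun a =>
    (by decide : ∀ b : ZMod 2, b = if b = 1 then 1 else 0) _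
  let B := Matrix.fromCols A (1 : Matrix m m ℤ)
  have hB : B.IsTotallyUnimodular := (Matrix.fromCols_one_isTotallyUnimodular_iff A).2 hA
  have hsub : ∀ {R : Type} [CommRing R] (i : m) (v : n ⊕ m → R), (∀ a, ¬ p a → v a = 0) →
      ∑ a : {a // p a}, (B i a : R) * v a = ∑ j, (A i j : R) * v (.inl j) + v (.inr i) := by
    intro R _ i v hv
    have h1 := Fintype.sum_subtype_add_sum_subtype p fun a => (B i a : R) * v a
    rw [Finset.sum_congr rfl fun (a : {a // ¬ p a}) _ => by rw [hv a a.2, mul_zero],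
      Finset.sum_const_zero, add_zero] at h1
    rw [h1, Fintype.sum_sum_type]
    simp [B, Matrix.one_apply]
  obtain ⟨v, hv, hv0⟩ := (hB.submatrix id (Subtype.val : {a // p a} → n ⊕ m)).exists_signing (by
    intro i
    have h1 := hsub i e fun a ha => by rw [he, if_neg ha]
    rw [Finset.sum_congr rfl fun (a : {a // p a}) _ => by rw [show e a = 1 from a.2, mul_one]] at h1
    refine h1.trans ?_
    simp only [e, Sum.elim_inl, Sum.elim_inr]
    exact CharTwo.add_self_eq_zero _)
  let s : n ⊕ m → ℤ := fun a => if ha : p a then v ⟨a, ha⟩ else 0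
  have hs : ∀ a, |s a| ≤ 1 := by
    intro a
    by_cases ha : p a
    · rcases hv ⟨a, ha⟩ with h | h <;> simp [s, ha, h]
    · simp [s, ha]
  have hse : ∀ a, (s a : ZMod 2) = e a := by
    intro a
    rw [he]
    by_cases ha : p a
    · rcases hv ⟨a, ha⟩ with h | h <;> simp [s, ha, h]
    · simp [s, ha]
  refine ⟨fun j => s (.inl j), fun j => hs _, fun j => ?_, fun i => ?_⟩
  · refine (ZMod.intCast_zmod_eq_zero_iff_dvd _ 2).1 ?_
    rw [Int.cast_sub, hse]
    exact sub_self _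
  · have h1 := hsub i s fun a ha => dif_neg ha
    rw [Finset.sum_congr rfl fun (a : {a // p a}) _ => by
      rw [show s a = v a from dif_pos a.2]] at h1
    have h2 := hv0 i
    simp only [Matrix.submatrix_apply, id_eq] at h2
    simp only [Int.cast_id] at h1
    rw [h2] at h1
    rw [eq_neg_of_add_eq_zero_left h1.symm, abs_neg]
    exact hs _

/-- Integer decomposition for two points: the sum of two integer points of a totally unimodular
polyhedron is the sum of two of its integer points that differ by at most one in each
coordinate. -/
theorem Matrix.IsTotallyUnimodular.exists_balanced_pair {m n : Type*} [Finite m] [Fintype n]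
    {A : Matrix m n ℤ} (hA : A.IsTotallyUnimodular) {b : m → ℤ} {x y : n → ℤ}
    (hx : ∀ i, ∑ j, A i j * x j ≤ b i) (hy : ∀ i, ∑ j, A i j * y j ≤ b i) :
    ∃ x' y' : n → ℤ, (∀ i, ∑ j, A i j * x' j ≤ b i) ∧ (∀ i, ∑ j, A i j * y' j ≤ b i) ∧
      (∀ j, x' j + y' j = x j + y j) ∧ ∀ j, |x' j - y' j| ≤ 1 := by
  obtain ⟨σ, hσ, hdvd, hrow⟩ := hA.exists_equitable_signing (x + y)
  choose t ht using hdvd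
  simp only [Pi.add_apply] at ht
  have hsum : ∀ i, ∑ j, A i j * x j + ∑ j, A i j * y j =
      2 * ∑ j, A i j * t j + ∑ j, A i j * σ j := by
    intro i
    rw [Finset.mul_sum, ← Finset.sum_add_distrib, ← Finset.sum_add_distrib]
    refine Finset.sum_congr rfl fun j _ => ?_
    linear_combination A i j * ht j
  refine ⟨fun j => t j + σ j, t, fun i => ?_, fun i => ?_, fun j => ?_, fun j => ?_⟩
  · simp only [mul_add, Finset.sum_add_distrib]
    have := abs_le.1 (hrow i)
    have := hsum i
    have := hx i
    have := hy i
    omega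
  · have := abs_le.1 (hrow i)
    have := hsum i
    have := hx i
    have := hy i
    omega
  · linarith [ht j]
  · simpa using hσ j


/-- TU case: improved lower bound on the gap between the maximum and minimum of
the separable concave quadratic `f` over the integer points of the polyhedron. -/
theorem stmt_12 (k n m : ℕ) (hk : 0 < k) (hkn : k ≤ n) (hm : 0 < m)
    (W : Matrix (Fin m) (Fin n) ℤ)
    (hTU : ∀ (s : ℕ) (r : Fin s → Fin m) (c : Fin s → Fin n),
      Function.Injective r → Function.Injective c →
      (W.submatrix r c).det = 0 ∨ (W.submatrix r c).det = 1 ∨ (W.submatrix r c).det = -1)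
    (w : Fin m → ℤ)
    (S : Set (Fin n → ℝ))
    (hS : S = {x | (∀ i, ∃ z : ℤ, x i = (z : ℝ)) ∧
                   ∀ j, (∑ i, (W j i : ℝ) * x i) ≤ (w j : ℝ)})
    (q : Fin k → ℝ) (hq : ∀ i, 0 < q i) (h : Fin n → ℝ)
    (f : (Fin n → ℝ) → ℝ)
    (hf : ∀ x, f x = (∑ i : Fin k, -(q i) * (x (Fin.castLE hkn i)) ^ 2) + ∑ i, h i * x i)
    (xstar : Fin n → ℝ) (hxstarS : xstar ∈ S) (hxstar : ∀ x ∈ S, f xstar ≤ f x)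
    (l u : Fin k → ℝ)
    (hl : ∀ i, (∃ y ∈ S, y (Fin.castLE hkn i) = l i) ∧ ∀ y ∈ S, l i ≤ y (Fin.castLE hkn i))
    (hu : ∀ i, (∃ y ∈ S, y (Fin.castLE hkn i) = u i) ∧ ∀ y ∈ S, y (Fin.castLE hkn i) ≤ u i)
    (g : ℝ) (hg : 0 < g) (hgap : ∀ i, g ≤ u i - l i)
    (γ : ℝ)
    (hγmax : ∀ i, q i * (u i - l i) ^ 2 ≤ γ) (hγatt : ∃ i, γ = q i * (u i - l i) ^ 2) :
    ∃ xY ∈ S, f xY - f xstar ≥ γ * (g ^ 2 - k) / (4 * g ^ 2) := by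
  have hA : W.IsTotallyUnimodular := by
    intro s r c hr hc
    rcases hTU s r c hr hc with h | h | h
    · exact ⟨0, by simp [h]⟩
    · exact ⟨1, by simp [h]⟩
    · exact ⟨-1, by simp [h]⟩
  have hmem : ∀ z : Fin n → ℤ, (fun i => (z i : ℝ)) ∈ S ↔ ∀ j, ∑ i, W j i * z i ≤ w j := by
    intro z
    rw [hS]
    have hcast : ∀ j, ∑ i, (W j i : ℝ) * (z i : ℝ) ≤ w j ↔ ∑ i, W j i * z i ≤ w j :=
      fun j => by norm_cast
    exact ⟨fun hz j => (hcast j).1 (hz.2 j),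
      fun hz => ⟨fun i => ⟨z i, rfl⟩, fun j => (hcast j).2 (hz j)⟩⟩
  have hint : ∀ x ∈ S, ∃ z : Fin n → ℤ, x = fun i => (z i : ℝ) := by
    intro x hx
    rw [hS] at hx
    choose z hz using hx.1
    exact ⟨z, funext hz⟩
  obtain ⟨i₀, hi₀⟩ := hγatt
  obtain ⟨a, ha, hal⟩ := (hl i₀).1
  obtain ⟨b, hb, hbu⟩ := (hu i₀).1
  have hfa := hxstar a ha
  have hfb := hxstar b hb
  obtain ⟨a, rfl⟩ := hint a ha
  obtain ⟨b, rfl⟩ := hint b hb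
  obtain ⟨y, z, hy, hz, hadd, hdiff⟩ :=
    hA.exists_balanced_pair ((hmem a).1 ha) ((hmem b).1 hb)
  rw [← hmem] at hy hz
  have hadd' : ∀ i, (y i : ℝ) + z i = a i + b i := fun i => by exact_mod_cast hadd i
  have hdiff' : ∀ i, ((y i : ℝ) - z i) ^ 2 ≤ 1 := fun i =>
    (sq_le_one_iff_abs_le_one _).2 (by exact_mod_cast hdiff i)
  let ι : Fin k → Fin n := Fin.castLE hkn
  have key : f (fun i => y i) + f (fun i => z i) = f (fun i => a i) + f (fun i => b i) +
      (∑ i, q i * ((a (ι i) : ℝ) - b (ι i)) ^ 2 - ∑ i, q i * ((y (ι i) : ℝ) - z (ι i)) ^ 2) / 2 := by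
    have hlin : ∑ i, h i * (y i : ℝ) + ∑ i, h i * (z i : ℝ) =
        ∑ i, h i * (a i : ℝ) + ∑ i, h i * (b i : ℝ) := by
      simp only [← Finset.sum_add_distrib, ← mul_add, hadd']
    have hquad : ∑ i, -(q i) * (y (ι i) : ℝ) ^ 2 + ∑ i, -(q i) * (z (ι i) : ℝ) ^ 2 =
        ∑ i, -(q i) * (a (ι i) : ℝ) ^ 2 + ∑ i, -(q i) * (b (ι i) : ℝ) ^ 2 +
        (∑ i, q i * ((a (ι i) : ℝ) - b (ι i)) ^ 2 -
          ∑ i, q i * ((y (ι i) : ℝ) - z (ι i)) ^ 2) / 2 := by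
      rw [← Finset.sum_sub_distrib, Finset.sum_div]
      simp only [← Finset.sum_add_distrib]
      refine Finset.sum_congr rfl fun i _ => ?_
      linear_combination (-(q i) / 2) * ((y (ι i) : ℝ) + z (ι i) + a (ι i) + b (ι i)) *
        hadd' (ι i)
    simp only [hf]
    linear_combination hlin + hquad
  have hlow : γ ≤ ∑ i, q i * ((a (ι i) : ℝ) - b (ι i)) ^ 2 := by
    refine le_trans (le_of_eq ?_) (Finset.single_le_sum
      (f := fun i => q i * ((a (ι i) : ℝ) - b (ι i)) ^ 2)
      (fun i _ => mul_nonneg (hq i).le (sq_nonneg _)) (Finset.mem_univ i₀))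
    rw [hi₀, ← hal, ← hbu]
    ring
  have hqg : ∀ i, q i ≤ γ / g ^ 2 := by
    intro i
    rw [le_div_iff₀ (by positivity)]
    exact (mul_le_mul_of_nonneg_left (pow_le_pow_left₀ hg.le (hgap i) 2) (hq i).le).trans (hγmax i)
  have hup : ∑ i, q i * ((y (ι i) : ℝ) - z (ι i)) ^ 2 ≤ k * (γ / g ^ 2) := by
    refine (Finset.sum_le_card_nsmul Finset.univ _ (γ / g ^ 2) fun i _ => ?_).trans (by simp)
    exact (mul_le_of_le_one_right (hq i).le (hdiff' _)).trans (hqg i)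
  have hrhs : γ * (g ^ 2 - k) / (4 * g ^ 2) = (γ - k * (γ / g ^ 2)) / 4 := by
    field_simp
  rw [hrhs]
  by_contra! hcon
  linarith [hcon _ hy, hcon _ hz]
end
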